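/- arXiv:1207.1789 — 3 statements merged into one kernel-verified Lean document; each statement's English description precedes it below -/
import Mathlib

section
/- Let 𝔗 be the 3-uniform clutter on [5] with circuits {1,2,4}, {1,3,4}, {2,3,4}, {1,2,5}, {1,3,5}, {2,3,5} (the faces of the triangular bipyramid with apexes 4 and 5 over the triangle {1,2,3}). For any circuit F ∈ 𝔗, let 𝔗' = 𝔗 \ {F}. Then the circuit ideal I(𝔗̄') ⊆ K[x_1,…,x_5] of the complement of 𝔗' has a 3-linear resolution. -/
open MvPolynomial

noncomputable section

/-- A graded free resolution of the ideal `I` over the polynomial ring `K[xᵢ : i ∈ σ]`: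
the `i`-th free module has rank `b i`, its `k`-th standard generator sits in degree
`deg i k`; `aug` is the augmentation map onto `I` and `d i` are the differentials.
All maps are graded (matrix entries are homogeneous of the appropriate degrees) and the
complex is exact. -/
def IsGradedFreeResolution {sig K : Type*} [Field K]
    (I : Ideal (MvPolynomial sig K)) (b : ℕ → ℕ) (deg : (i : ℕ) → Fin (b i) → ℕ)
    (aug : (Fin (b 0) → MvPolynomial sig K) →ₗ[MvPolynomial sig K] MvPolynomial sig K)
    (d : (i : ℕ) → ((Fin (b (i + 1)) → MvPolynomial sig K) →ₗ[MvPolynomial sig K]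
      (Fin (b i) → MvPolynomial sig K))) : Prop :=
  LinearMap.range aug = I ∧
  (∀ k, (aug (Pi.single k 1)).IsHomogeneous (deg 0 k)) ∧
  (∀ i k l, (d i) (Pi.single k 1) l = 0 ∨
    ∃ e, deg i l + e = deg (i + 1) k ∧ ((d i) (Pi.single k 1) l).IsHomogeneous e) ∧
  LinearMap.ker aug = LinearMap.range (d 0) ∧
  (∀ i, LinearMap.ker (d i) = LinearMap.range (d (i + 1)))

/-- `I` has a `q`-linear resolution: `I` has a graded free resolution in which the `i`-th
free module is generated entirely in degree `q + i`.  (Equivalently, `I` is generated in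
degree `q` and `β_{i,j}(I) = 0` whenever `j ≠ i + q`.) -/
def HasLinearResolution {sig K : Type*} [Field K] (q : ℕ)
    (I : Ideal (MvPolynomial sig K)) : Prop :=
  ∃ b deg aug d, IsGradedFreeResolution I b deg aug d ∧ ∀ i k, deg i k = q + i

/-- The Castelnuovo–Mumford regularity of `I`: the least `r` admitting a graded free
resolution of `I` whose `i`-th free module is generated in degrees `≤ r + i`.
(Equivalently, `reg I = sup { j - i : β_{i,j}(I) ≠ 0 }`.) -/
noncomputable def idealReg {sig K : Type*} [Field K] (I : Ideal (MvPolynomial sig K)) : ℕ :=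
  sInf {r : ℕ | ∃ b deg aug d, IsGradedFreeResolution I b deg aug d ∧ ∀ i k, deg i k ≤ r + i}

/-- The circuit ideal of a clutter `C` on `[n]`: the ideal generated by the square-free
monomials `x_F = ∏_{i ∈ F} x_i` for the circuits `F ∈ C`. -/
noncomputable def circuitIdeal {n : ℕ} (K : Type*) [Field K]
    (C : Finset (Finset (Fin n))) : Ideal (MvPolynomial (Fin n) K) :=
  Ideal.span ((fun F => ∏ i ∈ F, (MvPolynomial.X i : MvPolynomial (Fin n) K)) '' ↑C)

/-- The complement of a `d`-uniform clutter `C` on `[n]` inside the maximal `d`-uniform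
clutter `C_{n,d}` of all `d`-subsets of `[n]`. -/
def clutterCompl {n : ℕ} (d : ℕ) (C : Finset (Finset (Fin n))) : Finset (Finset (Fin n)) :=
  Finset.powersetCard d (Finset.univ : Finset (Fin n)) \ C

section Koszul

variable {R : Type*} [CommRing R] [IsDomain R] {a b c p q : R}

/-- The ideal `(abc, abp, apq, bpq, cpq)`, given by its list of generators. -/
def bipyramidGens (a b c p q : R) : Fin 5 → R :=
  ![a * b * c, a * b * p, a * p * q, b * p * q, c * p * q]

/-- The first syzygies of `bipyramidGens`. -/
def bipyramidSyz (a b c p q : R) : Fin 5 → Fin 5 → R :=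
  ![![-p, c, 0, 0, 0], ![0, -q, b, 0, 0], ![0, 0, -b, a, 0], ![0, 0, -c, 0, a],
    ![0, 0, 0, -c, b]]

/-- The second syzygy of `bipyramidGens`. -/
def bipyramidSyzTwo (a b c : R) : Fin 1 → Fin 5 → R :=
  ![![0, 0, -c, b, -a]]

theorem ker_bipyramidGens (ha : a ≠ 0) (hp0 : p ≠ 0) (hq0 : q ≠ 0)
    (hp : ∀ f, p ∣ a * b * c * f → p ∣ f) (hq : ∀ f, q ∣ a * b * f → q ∣ f)
    (hb : ∀ f, a ∣ b * f → a ∣ f)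
    (hc : ∀ f, c * f ∈ Ideal.span {a, b} → f ∈ Ideal.span {a, b}) :
    LinearMap.ker (Fintype.linearCombination R (bipyramidGens a b c p q)) =
      LinearMap.range (Fintype.linearCombination R (bipyramidSyz a b c p q)) := by
  ext f
  simp only [LinearMap.mem_ker, LinearMap.mem_range, Fintype.linearCombination_apply,
    bipyramidGens, bipyramidSyz, Fin.sum_univ_five, smul_eq_mul]
  constructor
  · intro h
    simp at h
    obtain ⟨x, hx⟩ := hp (f 0) ⟨-(a * b * f 1 + a * q * f 2 + b * q * f 3 + c * q * f 4), by
      linear_combination h⟩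
    have h1 : a * b * (f 1 + c * x) + q * (a * f 2 + b * f 3 + c * f 4) = 0 := by
      apply mul_left_cancel₀ hp0
      rw [hx] at h
      linear_combination h
    obtain ⟨y, hy⟩ := hq (f 1 + c * x) ⟨-(a * f 2 + b * f 3 + c * f 4), by
      linear_combination h1⟩
    have h2 : a * b * y + a * f 2 + b * f 3 + c * f 4 = 0 := by
      apply mul_left_cancel₀ hq0
      rw [hy] at h1
      linear_combination h1
    obtain ⟨u, v, huv⟩ := Ideal.mem_span_pair.1 <| hc (f 4) <| Ideal.mem_span_pair.2
      ⟨-(b * y + f 2), -f 3, by linear_combination -h2⟩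
    obtain ⟨z, hz⟩ := hb (f 3 + c * v) ⟨-(b * y + f 2 + c * u), by
      linear_combination h2 + c * huv⟩
    have h3 : b * y + f 2 + c * u + b * z = 0 := by
      apply mul_left_cancel₀ ha
      linear_combination h2 + c * huv - b * hz
    refine ⟨![-x, -y, z, u, v], ?_⟩
    ext i
    fin_cases i <;> simp
    · linear_combination -hx
    · linear_combination -hy
    · linear_combination -h3
    · linear_combination -hz
    · linear_combination huv
  · rintro ⟨g, rfl⟩
    simp
    ring

theorem ker_bipyramidSyz (ha : a ≠ 0) (hp0 : p ≠ 0) (hq0 : q ≠ 0)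
    (hac : ∀ f, a ∣ c * f → a ∣ f) :
    LinearMap.ker (Fintype.linearCombination R (bipyramidSyz a b c p q)) =
      LinearMap.range (Fintype.linearCombination R (bipyramidSyzTwo a b c)) := by
  ext g
  simp only [LinearMap.mem_ker, LinearMap.mem_range, Fintype.linearCombination_apply,
    bipyramidSyz, bipyramidSyzTwo, Fin.sum_univ_five, Fin.sum_univ_one]
  constructor
  · intro h
    have e0 := congrFun h 0
    have e1 := congrFun h 1
    have e3 := congrFun h 3
    have e4 := congrFun h 4
    simp [hp0] at e0
    simp [e0, hq0] at e1
    simp at e3 e4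
    obtain ⟨t, ht⟩ := hac (g 4) ⟨g 2, by linear_combination -e3⟩
    have h3 : g 3 + b * t = 0 := by
      apply mul_left_cancel₀ ha
      rw [ht] at e4
      linear_combination e4
    have h2 : g 2 - c * t = 0 := by
      apply mul_left_cancel₀ ha
      rw [ht] at e3
      linear_combination e3
    refine ⟨![-t], ?_⟩
    ext i
    fin_cases i <;> simp
    · exact e0.symm
    · exact e1.symm
    · linear_combination -h2
    · linear_combination -h3
    · linear_combination -ht
  · rintro ⟨t, rfl⟩
    ext i
    fin_cases i <;> simp <;> ring

theorem ker_bipyramidSyzTwo (ha : a ≠ 0) :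
    LinearMap.ker (Fintype.linearCombination R (bipyramidSyzTwo a b c)) = ⊥ := by
  refine (LinearMap.ker_eq_bot').2 fun t ht => ?_
  have h4 := congrFun ht 4
  simp [Fintype.linearCombination_apply, bipyramidSyzTwo, ha] at h4
  ext i
  fin_cases i
  exact h4

end Koszul

theorem X_dvd_of_dvd_X_mul {σ K : Type*} [Field K] {i j : σ} (hij : i ≠ j)
    {f : MvPolynomial σ K} (h : (X i : MvPolynomial σ K) ∣ X j * f) : X i ∣ f :=
  (X_prime.dvd_or_dvd h).resolve_left fun h' => hij (by simpa using h')

theorem mem_span_X_pair_of_X_mul_mem {σ K : Type*} [Field K] {i j k : σ} (hik : i ≠ k)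
    (hjk : j ≠ k) {f : MvPolynomial σ K}
    (h : X k * f ∈ Ideal.span {(X i : MvPolynomial σ K), X j}) :
    f ∈ Ideal.span {(X i : MvPolynomial σ K), X j} := by
  classical
  rw [← Set.image_pair, mem_ideal_span_X_image] at h ⊢
  intro m hm
  obtain ⟨l, hl, hml⟩ := h (Finsupp.single k 1 + m) (by
    rw [mem_support_iff, coeff_X_mul]
    exact mem_support_iff.1 hm)
  refine ⟨l, hl, ?_⟩
  have hlk : l ≠ k := by
    rcases hl with rfl | rfl <;> assumption
  simpa [Finsupp.single_apply, hlk.symm] using hml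

/-- The ranks of the free modules in the resolution of a bipyramid minus a circuit. -/
def bipyramidRank : ℕ → ℕ
  | 0 => 5
  | 1 => 5
  | 2 => 1
  | _ + 3 => 0

/-- The differentials in the resolution of a bipyramid minus a circuit. -/
def bipyramidDiff {R : Type*} [CommRing R] (a b c p q : R) : (i : ℕ) →
    ((Fin (bipyramidRank (i + 1)) → R) →ₗ[R] (Fin (bipyramidRank i) → R))
  | 0 => Fintype.linearCombination R (bipyramidSyz a b c p q)
  | 1 => Fintype.linearCombination R (bipyramidSyzTwo a b c)
  | _ + 2 => 0

theorem hasLinearResolution_bipyramidGens {σ K : Type*} [Field K] {a b c p q : σ}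
    (h : [a, b, c, p, q].Nodup) :
    HasLinearResolution 3 (Ideal.span (Set.range
      (bipyramidGens (X a : MvPolynomial σ K) (X b) (X c) (X p) (X q)))) := by
  simp only [List.nodup_cons, List.mem_cons, List.not_mem_nil, or_false, not_or] at h
  obtain ⟨⟨hab, hac, hap, haq⟩, ⟨hbc, hbp, hbq⟩, ⟨hcp, hcq⟩, hpq, -⟩ := h
  refine ⟨bipyramidRank, fun i _ => 3 + i,
    Fintype.linearCombination _ (bipyramidGens (X a) (X b) (X c) (X p) (X q)),
    bipyramidDiff (X a) (X b) (X c) (X p) (X q), ⟨?_, ?_, ?_, ?_, ?_⟩, fun _ _ => rfl⟩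
  · exact Fintype.range_linearCombination _ _
  · have key (i j k : σ) : (X i * X j * X k : MvPolynomial σ K).IsHomogeneous 3 :=
      ((isHomogeneous_X K i).mul (isHomogeneous_X K j)).mul (isHomogeneous_X K k)
    suffices ∀ k : Fin 5,
        (bipyramidGens (X a : MvPolynomial σ K) (X b) (X c) (X p) (X q) k).IsHomogeneous 3 by
      intro k
      erw [Fintype.linearCombination_apply_single, one_smul]
      exact this k
    intro k
    fin_cases k <;> exact key _ _ _
  · have key {r : MvPolynomial σ K} (i : ℕ) (hr : r = 0 ∨ r.IsHomogeneous 1) :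
        r = 0 ∨ ∃ e, 3 + i + e = 3 + (i + 1) ∧ r.IsHomogeneous e :=
      hr.imp_right fun hr => ⟨1, rfl, hr⟩
    have hX (i : σ) : (X i : MvPolynomial σ K).IsHomogeneous 1 := isHomogeneous_X K i
    have hX' (i : σ) : (-X i : MvPolynomial σ K).IsHomogeneous 1 := (hX i).neg
    intro i k l
    apply key
    match i with
    | 0 =>
      suffices ∀ k l : Fin 5,
          bipyramidSyz (X a : MvPolynomial σ K) (X b) (X c) (X p) (X q) k l = 0 ∨
          (bipyramidSyz (X a : MvPolynomial σ K) (X b) (X c) (X p) (X q) k l).IsHomogeneous 1 by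
        erw [Fintype.linearCombination_apply_single, one_smul]
        exact this k l
      intro k l
      fin_cases k <;> fin_cases l <;> simp [bipyramidSyz, hX, hX']
    | 1 =>
      suffices ∀ (k : Fin 1) (l : Fin 5),
          bipyramidSyzTwo (X a : MvPolynomial σ K) (X b) (X c) k l = 0 ∨
          (bipyramidSyzTwo (X a : MvPolynomial σ K) (X b) (X c) k l).IsHomogeneous 1 by
        erw [Fintype.linearCombination_apply_single, one_smul]
        exact this k l
      intro k l
      fin_cases k; fin_cases l <;> simp [bipyramidSyzTwo, hX, hX']
    | _ + 2 => exact Or.inl rfl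
  · refine ker_bipyramidGens (X_ne_zero a) (X_ne_zero p) (X_ne_zero q) (fun f hf => ?_)
      (fun f hf => ?_) (fun f => X_dvd_of_dvd_X_mul hab)
      (fun f => mem_span_X_pair_of_X_mul_mem hac hbc)
    · rw [mul_assoc, mul_assoc] at hf
      exact X_dvd_of_dvd_X_mul (Ne.symm hcp) <| X_dvd_of_dvd_X_mul (Ne.symm hbp) <|
        X_dvd_of_dvd_X_mul (Ne.symm hap) hf
    · rw [mul_assoc] at hf
      exact X_dvd_of_dvd_X_mul (Ne.symm hbq) <| X_dvd_of_dvd_X_mul (Ne.symm haq) hf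
  · intro i
    match i with
    | 0 =>
      exact ker_bipyramidSyz (R := MvPolynomial σ K) (X_ne_zero a) (X_ne_zero p) (X_ne_zero q)
        (fun f => X_dvd_of_dvd_X_mul hac)
    | 1 => exact (ker_bipyramidSyzTwo (R := MvPolynomial σ K) (X_ne_zero a)).trans LinearMap.range_zero.symm
    | n + 2 =>
      have : Subsingleton (Fin (bipyramidRank (n + 3)) → MvPolynomial σ K) :=
        inferInstanceAs (Subsingleton (Fin 0 → MvPolynomial σ K))
      exact Subsingleton.elim _ _

theorem hasLinearResolution_circuitIdeal {n : ℕ} (K : Type*) [Field K] {a b c p q : Fin n}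
    (h : [a, b, c, p, q].Nodup) :
    HasLinearResolution 3
      (circuitIdeal K {{c, p, q}, {b, p, q}, {a, p, q}, {a, b, p}, {a, b, c}}) := by
  convert hasLinearResolution_bipyramidGens (K := K) h using 1
  simp only [List.nodup_cons, List.mem_cons, List.not_mem_nil, or_false, not_or] at h
  obtain ⟨⟨hab, hac, hap, haq⟩, ⟨hbc, hbp, hbq⟩, ⟨hcp, hcq⟩, hpq, -⟩ := h
  simp [circuitIdeal, bipyramidGens, Matrix.range_cons, Set.image_insert_eq,
    Finset.prod_insert, ← mul_assoc, *]

/-- Let `𝔗` be the 3-uniform clutter on `[5]` given by the faces of the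
triangular bipyramid with apexes `4, 5` over the triangle `{1,2,3}` (vertices `1,…,5`
realized as `0,…,4 : Fin 5`), i.e.
`𝔗 = {{1,2,4},{1,3,4},{2,3,4},{1,2,5},{1,3,5},{2,3,5}}`.  For any circuit `F ∈ 𝔗`,
the circuit ideal of the complement of `𝔗' = 𝔗 \ {F}` has a 3-linear resolution. -/
theorem bipyramid_minus_circuit_linear {K : Type*} [Field K] :
    ∀ F ∈ ({({0, 1, 3} : Finset (Fin 5)), {0, 2, 3}, {1, 2, 3}, {0, 1, 4}, {0, 2, 4},
        {1, 2, 4}} : Finset (Finset (Fin 5))),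
      HasLinearResolution 3
        (circuitIdeal K (clutterCompl 3
          ((({({0, 1, 3} : Finset (Fin 5)), {0, 2, 3}, {1, 2, 3}, {0, 1, 4}, {0, 2, 4},
            {1, 2, 4}} : Finset (Finset (Fin 5)))).erase F))) := by
  simp only [Finset.forall_mem_insert, Finset.mem_singleton, forall_eq]
  refine ⟨?_, ?_, ?_, ?_, ?_, ?_⟩
  · convert hasLinearResolution_circuitIdeal K (n := 5) (a := 0) (b := 1) (c := 2) (p := 3) (q := 4)
      (by decide) using 2
    decide
  · convert hasLinearResolution_circuitIdeal K (n := 5) (a := 0) (b := 2) (c := 1) (p := 3) (q := 4)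
      (by decide) using 2
    decide
  · convert hasLinearResolution_circuitIdeal K (n := 5) (a := 1) (b := 2) (c := 0) (p := 3) (q := 4)
      (by decide) using 2
    decide
  · convert hasLinearResolution_circuitIdeal K (n := 5) (a := 0) (b := 1) (c := 2) (p := 4) (q := 3)
      (by decide) using 2
    decide
  · convert hasLinearResolution_circuitIdeal K (n := 5) (a := 0) (b := 2) (c := 1) (p := 4) (q := 3)
      (by decide) using 2
    decide
  · convert hasLinearResolution_circuitIdeal K (n := 5) (a := 1) (b := 2) (c := 0) (p := 4) (q := 3)
      (by decide) using 2
    decide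
end
end

section
/- Let 𝔓_n be the 3-uniform clutter on n ≥ 5 vertices whose circuits are the triangular faces of a triangulation of the 2-sphere. For any proper subclutter C_1 ⊊ 𝔓_n, the circuit ideal I(C̄_1) ⊆ K[x_1,…,x_n] of the complement of C_1 has a 3-linear resolution. -/
open MvPolynomial

noncomputable section

/-- A (combinatorial) triangulation of the 2-sphere with vertex set `[n]`, presented as the
3-uniform clutter of its triangular faces: every vertex lies in a face, every edge lies in
exactly two faces, two distinct faces share at most one edge, the link of every vertex is
connected (hence a single cycle), the 1-skeleton is connected, and the Euler relation
`V - E + F = 2` holds. -/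
def IsSphereTriangulation {n : ℕ} (C : Finset (Finset (Fin n))) : Prop :=
  (∀ F ∈ C, F.card = 3) ∧
  (∀ v : Fin n, ∃ F ∈ C, v ∈ F) ∧
  (∀ e : Finset (Fin n), e.card = 2 → (∃ F ∈ C, e ⊆ F) →
    (C.filter (fun F => e ⊆ F)).card = 2) ∧
  (∀ F ∈ C, ∀ G ∈ C, F ≠ G → (F ∩ G).card ≤ 2) ∧
  (∀ v u w : Fin n, u ≠ v → w ≠ v → (∃ F ∈ C, v ∈ F ∧ u ∈ F) →
    (∃ F ∈ C, v ∈ F ∧ w ∈ F) →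
    Relation.ReflTransGen (fun a b : Fin n => a ≠ b ∧ ({v, a, b} : Finset (Fin n)) ∈ C) u w) ∧
  (∀ u w : Fin n,
    Relation.ReflTransGen (fun a b : Fin n => a ≠ b ∧ ∃ F ∈ C, a ∈ F ∧ b ∈ F) u w) ∧
  n + C.card =
    ((Finset.powersetCard 2 (Finset.univ : Finset (Fin n))).filter
      (fun e => ∃ F ∈ C, e ⊆ F)).card + 2

open scoped TensorProduct

/-- The degree projections of a graded module over a polynomial ring. Only the compatibility of
the projections with multiplication by scalars is recorded. -/
structure ModuleGrading (K sig M : Type*) [Field K] [AddCommGroup M] [Module K M]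
    [Module (MvPolynomial sig K) M] where
  /-- The projection onto the component of the given degree. -/
  proj : ℕ → M →ₗ[K] M
  proj_proj : ∀ d m, proj d (proj d m) = proj d m
  proj_add_smul : ∀ (d j : ℕ) (s : MvPolynomial sig K) (m : M),
    proj (j + d) (s • proj d m) = homogeneousComponent j s • proj d m
  proj_smul_of_lt : ∀ (d i : ℕ) (s : MvPolynomial sig K) (m : M), i < d →
    proj i (s • proj d m) = 0

namespace ModuleGrading

section Basic

variable {K sig M N : Type*} [Field K] [AddCommGroup M] [Module K M]
  [Module (MvPolynomial sig K) M] [AddCommGroup N] [Module K N]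
  [Module (MvPolynomial sig K) N]

/-- The component of degree `d` of a graded module. -/
def piece (G : ModuleGrading K sig M) (d : ℕ) : Submodule K M where
  carrier := {m | G.proj d m = m}
  add_mem' := by
    intro a b ha hb
    simp_all
  zero_mem' := by simp
  smul_mem' := by
    intro c x hx
    simp_all

lemma mem_piece {G : ModuleGrading K sig M} {d : ℕ} {m : M} :
    m ∈ G.piece d ↔ G.proj d m = m := Iff.rfl

lemma proj_mem_piece (G : ModuleGrading K sig M) (d : ℕ) (m : M) : G.proj d m ∈ G.piece d :=
  G.proj_proj d m

/-- The grading of a polynomial ring by total degree. -/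
def polynomial (K sig : Type*) [Field K] : ModuleGrading K sig (MvPolynomial sig K) where
  proj := homogeneousComponent
  proj_proj d m := homogeneousComponent_eq_self (homogeneousComponent_isHomogeneous d m)
  proj_add_smul d j s m := by
    let := MvPolynomial.gradedAlgebra (σ := sig) (R := K)
    have h := DirectSum.coe_decompose_mul_add_of_right_mem (homogeneousSubmodule sig K)
      (i := j) (j := d) (a := s) (homogeneousComponent_isHomogeneous d m)
    exact (decomposition.decompose'_apply _ _).symm.trans
      (h.trans (congrArg (· * _) (decomposition.decompose'_apply s j)))
  proj_smul_of_lt d i s m hi := by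
    let := MvPolynomial.gradedAlgebra (σ := sig) (R := K)
    have h := DirectSum.coe_decompose_mul_of_right_mem_of_not_le (homogeneousSubmodule sig K)
      (a := s) (homogeneousComponent_isHomogeneous d m) (not_le.mpr hi)
    exact (decomposition.decompose'_apply _ _).symm.trans h

/-- The grading on a free module whose generators sit in degree zero. -/
def extendScalars (K sig V : Type*) [Field K] [AddCommGroup V] [Module K V] :
    ModuleGrading K sig (MvPolynomial sig K ⊗[K] V) where
  proj j := (homogeneousComponent j).rTensor V
  proj_proj d m := by
    induction m with
    | zero => simp
    | tmul s v =>
      simp [homogeneousComponent_eq_self (homogeneousComponent_isHomogeneous d s)]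
    | add x y hx hy => simp only [map_add, hx, hy]
  proj_add_smul d j s m := by
    induction m with
    | zero => simp
    | tmul t v =>
      have := (polynomial K sig).proj_add_smul d j s t
      simp only [polynomial, smul_eq_mul] at this
      simp [TensorProduct.smul_tmul', this]
    | add x y hx hy => simp only [map_add, smul_add, hx, hy]
  proj_smul_of_lt d i s m hi := by
    induction m with
    | zero => simp
    | tmul t v =>
      have := (polynomial K sig).proj_smul_of_lt d i s t hi
      simp only [polynomial, smul_eq_mul] at this
      simp [TensorProduct.smul_tmul', this]
    | add x y hx hy => simp only [map_add, smul_add, hx, hy, add_zero]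

/-- The grading on the direct sum of two graded modules. -/
def prod (G : ModuleGrading K sig M) (H : ModuleGrading K sig N) :
    ModuleGrading K sig (M × N) where
  proj j := (G.proj j).prodMap (H.proj j)
  proj_proj d m := by simp [G.proj_proj, H.proj_proj]
  proj_add_smul d j s m := by ext <;> simp [G.proj_add_smul, H.proj_add_smul]
  proj_smul_of_lt d i s m hi := by
    ext <;> simp [G.proj_smul_of_lt _ _ _ _ hi, H.proj_smul_of_lt _ _ _ _ hi]

variable [IsScalarTower K (MvPolynomial sig K) M] [IsScalarTower K (MvPolynomial sig K) N]

/-- The grading induced on a submodule closed under all projections. -/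
def restrict (G : ModuleGrading K sig M) (N : Submodule (MvPolynomial sig K) M)
    (hN : ∀ j, ∀ m ∈ N, G.proj j m ∈ N) : ModuleGrading K sig N where
  proj j := (G.proj j).restrict (p := N.restrictScalars K) (q := N.restrictScalars K) (hN j)
  proj_proj d m := Subtype.ext (G.proj_proj d m)
  proj_add_smul d j s m := Subtype.ext (G.proj_add_smul d j s m)
  proj_smul_of_lt d i s m hi := Subtype.ext (G.proj_smul_of_lt d i s m hi)

/-- The canonical map from the free module on the component of degree `d`. -/
def mult (G : ModuleGrading K sig M) (d : ℕ) :
    MvPolynomial sig K ⊗[K] G.piece d →ₗ[MvPolynomial sig K] M :=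
  (G.piece d).subtype.liftBaseChange (MvPolynomial sig K)

@[simp]
lemma mult_tmul (G : ModuleGrading K sig M) (d : ℕ) (s : MvPolynomial sig K) (v : G.piece d) :
    G.mult d (s ⊗ₜ v) = s • (v : M) := by simp [mult]

lemma mult_proj (G : ModuleGrading K sig M) (d j : ℕ)
    (z : MvPolynomial sig K ⊗[K] G.piece d) :
    G.mult d ((extendScalars K sig (G.piece d)).proj j z) = G.proj (j + d) (G.mult d z) := by
  induction z with
  | zero => simp
  | tmul s v =>
    have := G.proj_add_smul d j s v
    rw [v.2] at this
    simp [extendScalars, this]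
  | add x y hx hy => simp only [map_add, hx, hy]

/-- The module of relations between the elements of degree `d`. -/
abbrev syz (G : ModuleGrading K sig M) (d : ℕ) :
    Submodule (MvPolynomial sig K) (MvPolynomial sig K ⊗[K] G.piece d) :=
  LinearMap.ker (G.mult d)

/-- The grading on the module of relations. -/
def syzGrading (G : ModuleGrading K sig M) (d : ℕ) : ModuleGrading K sig (G.syz d) :=
  (extendScalars K sig (G.piece d)).restrict (G.syz d) fun j z hz => by
    rw [LinearMap.mem_ker] at hz ⊢
    rw [mult_proj, hz, map_zero]

/-- The map induced in degrees `a → b` by a linear map commuting with the projections. -/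
def pieceMap (G : ModuleGrading K sig M) (H : ModuleGrading K sig N) {a b : ℕ}
    (f : M →ₗ[MvPolynomial sig K] N) (hf : ∀ x, f (G.proj a x) = H.proj b (f x)) :
    G.piece a →ₗ[K] H.piece b :=
  (f.restrictScalars K).restrict fun x hx => by
    rw [mem_piece] at hx ⊢
    simp [← hf, hx]

variable {G : ModuleGrading K sig M} {H : ModuleGrading K sig N} {a b : ℕ}
  {f : M →ₗ[MvPolynomial sig K] N}

@[simp]
lemma coe_pieceMap (hf : ∀ x, f (G.proj a x) = H.proj b (f x)) (x : G.piece a) :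
    (G.pieceMap H f hf x : N) = f x := rfl

lemma mult_baseChange_pieceMap (hf : ∀ x, f (G.proj a x) = H.proj b (f x))
    (z : MvPolynomial sig K ⊗[K] G.piece a) :
    H.mult b ((G.pieceMap H f hf).baseChange (MvPolynomial sig K) z) = f (G.mult a z) := by
  induction z with
  | zero => simp
  | tmul s v => simp
  | add x y hx hy => simp only [map_add, hx, hy]

lemma baseChange_proj {V W : Type*} [AddCommGroup V] [Module K V] [AddCommGroup W] [Module K W]
    (φ : V →ₗ[K] W) (j : ℕ) (z : MvPolynomial sig K ⊗[K] V) :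
    φ.baseChange (MvPolynomial sig K) ((extendScalars K sig V).proj j z) =
      (extendScalars K sig W).proj j (φ.baseChange (MvPolynomial sig K) z) := by
  induction z with
  | zero => simp
  | tmul s v => simp [extendScalars]
  | add x y hx hy => simp only [map_add, hx, hy]

/-- The map induced on relations by a linear map commuting with the projections. -/
def syzMap (G : ModuleGrading K sig M) (H : ModuleGrading K sig N)
    (f : M →ₗ[MvPolynomial sig K] N) (hf : ∀ x, f (G.proj a x) = H.proj b (f x)) :
    G.syz a →ₗ[MvPolynomial sig K] H.syz b :=
  ((G.pieceMap H f hf).baseChange (MvPolynomial sig K)).restrict fun z hz => by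
    rw [LinearMap.mem_ker] at hz ⊢
    rw [mult_baseChange_pieceMap, hz, map_zero]

@[simp]
lemma coe_syzMap (hf : ∀ x, f (G.proj a x) = H.proj b (f x)) (z : G.syz a) :
    (G.syzMap H f hf z : MvPolynomial sig K ⊗[K] H.piece b) =
      (G.pieceMap H f hf).baseChange (MvPolynomial sig K) z := rfl

lemma syzMap_proj (hf : ∀ x, f (G.proj a x) = H.proj b (f x)) (j : ℕ) (z : G.syz a) :
    G.syzMap H f hf ((G.syzGrading a).proj j z) =
      (H.syzGrading b).proj j (G.syzMap H f hf z) :=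
  Subtype.ext (baseChange_proj _ j _)

lemma piece_eq_bot_of_lt (hG : Function.Surjective (G.mult b)) (h : a < b) :
    G.piece a = ⊥ := by
  rw [eq_bot_iff]
  intro m hm
  obtain ⟨z, rfl⟩ := hG m
  rw [mem_piece] at hm
  rw [Submodule.mem_bot, ← hm]
  clear hm
  induction z with
  | zero => simp
  | tmul s v =>
    have := G.proj_smul_of_lt b a s v h
    rw [v.2] at this
    simpa using this
  | add x y hx hy => simp only [map_add, hx, hy, add_zero]

end Basic

section Linear

universe u v

/-- The first `k` steps of the resolution of a graded module are finite and linear, starting from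
generators of degree `d`. -/
def IsLinear {K : Type u} {sig : Type v} [Field K] : ℕ → ∀ {M : Type (max u v)} [AddCommGroup M]
    [Module K M] [Module (MvPolynomial sig K) M] [IsScalarTower K (MvPolynomial sig K) M],
    ModuleGrading K sig M → ℕ → Prop
  | 0, _, _, _, _, _, _, _ => True
  | k + 1, _, _, _, _, _, G, d =>
    Module.Finite K (G.piece d) ∧ Function.Surjective (G.mult d) ∧
      IsLinear k (G.syzGrading d) 1

variable {K : Type u} {sig : Type v} [Field K] {A B C : Type (max u v)}
  [AddCommGroup A] [Module K A] [Module (MvPolynomial sig K) A]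
  [IsScalarTower K (MvPolynomial sig K) A]
  [AddCommGroup B] [Module K B] [Module (MvPolynomial sig K) B]
  [IsScalarTower K (MvPolynomial sig K) B]
  [AddCommGroup C] [Module K C] [Module (MvPolynomial sig K) C]
  [IsScalarTower K (MvPolynomial sig K) C]

lemma IsLinear.of_subsingleton (k : ℕ) [Subsingleton A] (G : ModuleGrading K sig A) (d : ℕ) :
    IsLinear k G d := by
  induction k generalizing A d with
  | zero => trivial
  | succ k ih =>
    have : Subsingleton (MvPolynomial sig K ⊗[K] G.piece d) :=
      subsingleton_of_forall_eq 0 fun z => by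
        induction z with
        | zero => rfl
        | tmul s v => rw [Subsingleton.elim v 0, TensorProduct.tmul_zero]
        | add x y hx hy => rw [hx, hy, add_zero]
    exact ⟨inferInstance, fun x => ⟨0, Subsingleton.elim _ _⟩, ih _ _⟩

/-- A retract of a linear module is linear. -/
lemma IsLinear.retract (k : ℕ) {G : ModuleGrading K sig A} {H : ModuleGrading K sig B} {a b : ℕ}
    (i : A →ₗ[MvPolynomial sig K] B) (p : B →ₗ[MvPolynomial sig K] A)
    (hi : ∀ x, i (G.proj a x) = H.proj b (i x)) (hp : ∀ x, p (H.proj b x) = G.proj a (p x))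
    (hpi : ∀ x, p (i x) = x) (hH : IsLinear k H b) : IsLinear k G a := by
  induction k generalizing A B a b with
  | zero => trivial
  | succ k ih =>
    obtain ⟨hfin, hsurj, hlin⟩ := hH
    have hcomp : (H.pieceMap G p hp).comp (G.pieceMap H i hi) = LinearMap.id := by
      ext x
      simp [hpi]
    refine ⟨Module.Finite.of_surjective (H.pieceMap G p hp) fun x =>
      ⟨G.pieceMap H i hi x, LinearMap.congr_fun hcomp x⟩, fun x => ?_,
      ih (G.syzMap H i hi) (H.syzMap G p hp) (syzMap_proj hi 1) (syzMap_proj hp 1) (fun z => ?_)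
        hlin⟩
    · obtain ⟨w, hw⟩ := hsurj (i x)
      exact ⟨_, by rw [mult_baseChange_pieceMap hp, hw, hpi]⟩
    · apply Subtype.ext
      rw [coe_syzMap, coe_syzMap, ← LinearMap.comp_apply, ← LinearMap.baseChange_comp, hcomp,
        LinearMap.baseChange_id, LinearMap.id_apply]

/-- An extension of linear modules is linear. -/
lemma IsLinear.extension (k : ℕ) {G : ModuleGrading K sig A} {H : ModuleGrading K sig B}
    {L : ModuleGrading K sig C} {a b c : ℕ}
    (f : A →ₗ[MvPolynomial sig K] B) (g : B →ₗ[MvPolynomial sig K] C)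
    (hf : ∀ x, f (G.proj a x) = H.proj b (f x)) (hg : ∀ x, g (H.proj b x) = L.proj c (g x))
    (hinj : Function.Injective f) (hex : Function.Exact f g) (hsurj : Function.Surjective g)
    (hG : IsLinear k G a) (hL : IsLinear k L c) : IsLinear k H b := by
  induction k generalizing A B C a b c with
  | zero => trivial
  | succ k ih =>
    obtain ⟨hGfin, hGsurj, hGlin⟩ := hG
    obtain ⟨hLfin, hLsurj, hLlin⟩ := hL
    have hpinj : Function.Injective (G.pieceMap H f hf) := fun x y hxy =>
      Subtype.ext (hinj congr(($hxy : B)))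
    have hpsurj : Function.Surjective (H.pieceMap L g hg) := fun x => by
      obtain ⟨y, hy⟩ := hsurj x
      refine ⟨⟨H.proj b y, H.proj_mem_piece b y⟩, Subtype.ext ?_⟩
      rw [coe_pieceMap, hg, hy, x.2]
    have hpex : Function.Exact (G.pieceMap H f hf) (H.pieceMap L g hg) := fun y => by
      constructor
      · intro hy
        obtain ⟨x, hx⟩ := (hex y).1 congr(($hy : C))
        refine ⟨⟨G.proj a x, G.proj_mem_piece a x⟩, Subtype.ext ?_⟩
        rw [coe_pieceMap, hf, hx, y.2]
      · rintro ⟨x, rfl⟩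
        exact Subtype.ext (hex.apply_apply_eq_zero x)
    have htinj := Module.Flat.lTensor_preserves_injective_linearMap (M := MvPolynomial sig K)
      _ hpinj
    have htsurj := LinearMap.lTensor_surjective (MvPolynomial sig K) hpsurj
    have htex := lTensor_exact (MvPolynomial sig K) hpex hpsurj
    refine ⟨Module.Finite.of_exact hpex hpsurj, fun x => ?_,
      ih (G.syzMap H f hf) (H.syzMap L g hg) (syzMap_proj hf 1) (syzMap_proj hg 1) ?_ ?_ ?_
        hGlin hLlin⟩
    · obtain ⟨w, hw⟩ := hLsurj (g x)
      obtain ⟨w, rfl⟩ := htsurj w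
      have hw' : g (x - H.mult b w) = 0 := by
        rw [map_sub, ← mult_baseChange_pieceMap hg, ← hw, LinearMap.baseChange_eq_ltensor,
          sub_self]
      obtain ⟨y, hy⟩ := (hex _).1 hw'
      obtain ⟨v, rfl⟩ := hGsurj y
      refine ⟨w + (G.pieceMap H f hf).baseChange _ v, ?_⟩
      rw [map_add, mult_baseChange_pieceMap hf, hy, add_sub_cancel]
    · exact fun x y hxy => Subtype.ext (htinj congr(($hxy : MvPolynomial sig K ⊗[K] H.piece b)))
    · intro z
      constructor
      · intro hz
        obtain ⟨w, hw⟩ := (htex z).1 congr(($hz : MvPolynomial sig K ⊗[K] L.piece c))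
        refine ⟨⟨w, hinj ?_⟩, Subtype.ext hw⟩
        rw [← mult_baseChange_pieceMap hf, LinearMap.baseChange_eq_ltensor, hw, map_zero]
        exact z.2
      · rintro ⟨x, rfl⟩
        exact Subtype.ext (htex.apply_apply_eq_zero x)
    · rintro ⟨w, hw⟩
      obtain ⟨w, rfl⟩ := htsurj w
      have hw' : g (H.mult b w) = 0 := by
        rw [← mult_baseChange_pieceMap hg, LinearMap.baseChange_eq_ltensor]
        exact hw
      obtain ⟨y, hy⟩ := (hex _).1 hw'
      obtain ⟨v, rfl⟩ := hGsurj y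
      refine ⟨⟨w - (G.pieceMap H f hf).baseChange _ v, ?_⟩, Subtype.ext ?_⟩
      · rw [LinearMap.mem_ker, map_sub, mult_baseChange_pieceMap hf, hy, sub_self]
      · rw [coe_syzMap, LinearMap.baseChange_eq_ltensor, map_sub, LinearMap.baseChange_eq_ltensor,
          htex.apply_apply_eq_zero, sub_zero]

/-- The quotient of a linear module by a linear submodule generated one degree higher is linear. -/
lemma IsLinear.quotient (k : ℕ) {G : ModuleGrading K sig A} {H : ModuleGrading K sig B}
    {L : ModuleGrading K sig C} {d : ℕ}
    (f : A →ₗ[MvPolynomial sig K] B) (g : B →ₗ[MvPolynomial sig K] C)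
    (hf : ∀ j x, f (G.proj j x) = H.proj j (f x)) (hg : ∀ x, g (H.proj d x) = L.proj d (g x))
    (hinj : Function.Injective f) (hex : Function.Exact f g) (hsurj : Function.Surjective g)
    (hG : ∀ k, IsLinear k G (d + 1)) (hH : IsLinear k H d) : IsLinear k L d := by
  cases k with
  | zero => trivial
  | succ k =>
    obtain ⟨hHfin, hHsurj, hHlin⟩ := hH
    have hGbot : G.piece d = ⊥ := piece_eq_bot_of_lt (hG 1).2.1 d.lt_succ_self
    have hpsurj : Function.Surjective (H.pieceMap L g hg) := fun x => by
      obtain ⟨y, hy⟩ := hsurj x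
      refine ⟨⟨H.proj d y, H.proj_mem_piece d y⟩, Subtype.ext ?_⟩
      rw [coe_pieceMap, hg, hy, x.2]
    have hpinj : Function.Injective (H.pieceMap L g hg) := by
      rw [← LinearMap.ker_eq_bot, LinearMap.ker_eq_bot']
      intro y hy
      obtain ⟨x, hx⟩ := (hex y).1 congr(($hy : C))
      have hx' : G.proj d x ∈ G.piece d := G.proj_mem_piece d x
      rw [hGbot, Submodule.mem_bot] at hx'
      apply Subtype.ext
      rw [← y.2, ← hx, ← hf, hx', map_zero, Submodule.coe_zero]
    let e := (LinearEquiv.ofBijective _ ⟨hpinj, hpsurj⟩).baseChange K (MvPolynomial sig K) _ _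
    have he (w : MvPolynomial sig K ⊗[K] H.piece d) : L.mult d (e w) = g (H.mult d w) :=
      mult_baseChange_pieceMap hg w
    have heproj (j : ℕ) (w : MvPolynomial sig K ⊗[K] H.piece d) :
        e ((extendScalars K sig _).proj j w) = (extendScalars K sig _).proj j (e w) :=
      baseChange_proj _ j w
    let eA := LinearEquiv.ofInjective f hinj
    have heA (x) (hx : x ∈ LinearMap.range f) : f (eA.symm ⟨x, hx⟩) = x :=
      congrArg Subtype.val (eA.apply_symm_apply ⟨x, hx⟩)
    let q : L.syz d →ₗ[MvPolynomial sig K] A := eA.symm.toLinearMap ∘ₗ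
      (H.mult d ∘ₗ e.symm.toLinearMap ∘ₗ (L.syz d).subtype).codRestrict (LinearMap.range f)
        fun z => (hex _).1 <| by
          have hz := z.2
          rw [LinearMap.mem_ker] at hz
          simp [← he, hz]
    have hq (z : L.syz d) : f (q z) = H.mult d (e.symm z) := heA _ _
    have hqproj (z : L.syz d) : q ((L.syzGrading d).proj 1 z) = G.proj (d + 1) (q z) := by
      apply hinj
      rw [hf, hq, hq, add_comm d, ← mult_proj]
      congr 1
      rw [LinearEquiv.symm_apply_eq, heproj, LinearEquiv.apply_symm_apply]
      rfl
    refine ⟨Module.Finite.of_surjective _ hpsurj, fun x => ?_,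
      IsLinear.extension k (H.syzMap L g hg) q (syzMap_proj hg 1) hqproj
        (fun x y hxy => Subtype.ext (e.injective (congrArg Subtype.val hxy)))
        (fun z => ⟨fun hz => ?_, ?_⟩) (fun x => ?_) hHlin (hG k)⟩
    · obtain ⟨y, rfl⟩ := hsurj x
      obtain ⟨w, rfl⟩ := hHsurj y
      exact ⟨e w, he w⟩
    · refine ⟨⟨e.symm z, ?_⟩, Subtype.ext (e.apply_symm_apply z)⟩
      rw [LinearMap.mem_ker, ← hq, hz, map_zero]
    · rintro ⟨w, rfl⟩
      apply hinj
      rw [hq, map_zero]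
      have : e.symm (H.syzMap L g hg w) = w := e.symm_apply_apply w
      rw [this]
      exact w.2
    · obtain ⟨w, hw⟩ := hHsurj (f x)
      refine ⟨⟨e w, ?_⟩, hinj ?_⟩
      · rw [LinearMap.mem_ker, he, hw, hex.apply_apply_eq_zero]
      · rw [hq, LinearEquiv.symm_apply_apply, hw]

end Linear

section Resolution

universe u v

/-- A graded module together with a distinguished degree. -/
structure GradedMod (K : Type u) (sig : Type v) [Field K] where
  /-- The underlying module. -/
  carrier : Type (max u v)
  [addCommGroup : AddCommGroup carrier]
  [moduleField : Module K carrier]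
  [modulePoly : Module (MvPolynomial sig K) carrier]
  [isScalarTower : IsScalarTower K (MvPolynomial sig K) carrier]
  /-- The grading. -/
  grading : ModuleGrading K sig carrier
  /-- The degree of the generators. -/
  deg : ℕ

attribute [instance] GradedMod.addCommGroup GradedMod.moduleField GradedMod.modulePoly
  GradedMod.isScalarTower

namespace GradedMod

variable {K : Type u} {sig : Type v} [Field K]

/-- The component in the distinguished degree. -/
abbrev gens (X : GradedMod K sig) : Submodule K X.carrier := X.grading.piece X.deg

/-- The module of linear relations, generated in degree one. -/
def next (X : GradedMod K sig) : GradedMod K sig where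
  carrier := X.grading.syz X.deg
  grading := X.grading.syzGrading X.deg
  deg := 1

/-- The iterated modules of linear relations. -/
def syzygy (X : GradedMod K sig) : ℕ → GradedMod K sig
  | 0 => X
  | i + 1 => (X.syzygy i).next

lemma isLinear_syzygy (X : GradedMod K sig) (hX : ∀ k, IsLinear k X.grading X.deg) (i k : ℕ) :
    IsLinear k (X.syzygy i).grading (X.syzygy i).deg := by
  induction i generalizing k with
  | zero => exact hX k
  | succ i ih => exact (ih (k + 1)).2.2

variable (X : GradedMod K sig) [Module.Finite K X.gens]

/-- Coordinates on the free module on the generators. -/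
def coord : MvPolynomial sig K ⊗[K] X.gens ≃ₗ[MvPolynomial sig K]
    (Fin (Module.finrank K X.gens) → MvPolynomial sig K) :=
  ((Module.finBasis K X.gens).baseChange (MvPolynomial sig K)).equivFun

lemma coord_symm_single (k : Fin (Module.finrank K X.gens)) :
    X.coord.symm (Pi.single k 1) = 1 ⊗ₜ Module.finBasis K X.gens k := by
  rw [LinearEquiv.symm_apply_eq, coord, ← Module.Basis.baseChange_apply]
  ext l
  simp [Pi.single_apply, Finsupp.single_apply, eq_comm]

lemma coord_proj (j : ℕ) (z : MvPolynomial sig K ⊗[K] X.gens)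
    (l : Fin (Module.finrank K X.gens)) :
    X.coord ((extendScalars K sig X.gens).proj j z) l = homogeneousComponent j (X.coord z l) := by
  induction z with
  | zero => simp
  | tmul s v => simp [coord, extendScalars, Module.Basis.baseChange_repr_tmul]
  | add x y hx hy => simp only [map_add, Pi.add_apply, hx, hy]

/-- The cover of a graded module by a free module. -/
def cover : (Fin (Module.finrank K X.gens) → MvPolynomial sig K) →ₗ[MvPolynomial sig K]
    X.carrier :=
  X.grading.mult X.deg ∘ₗ X.coord.symm.toLinearMap

lemma cover_single (k : Fin (Module.finrank K X.gens)) :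
    X.cover (Pi.single k 1) = Module.finBasis K X.gens k := by
  simp [cover, coord_symm_single]

lemma cover_surjective (h : Function.Surjective (X.grading.mult X.deg)) :
    Function.Surjective X.cover := h.comp X.coord.symm.surjective

/-- The inclusion of the linear relations in the free module. -/
def incl (X : GradedMod K sig) :
    X.next.carrier →ₗ[MvPolynomial sig K] MvPolynomial sig K ⊗[K] X.gens :=
  (X.grading.syz X.deg).subtype

lemma ker_incl (X : GradedMod K sig) : LinearMap.ker X.incl = ⊥ :=
  (X.grading.syz X.deg).ker_subtype

lemma range_incl (X : GradedMod K sig) :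
    LinearMap.range X.incl = LinearMap.ker (X.grading.mult X.deg) :=
  (X.grading.syz X.deg).range_subtype

lemma incl_proj (X : GradedMod K sig) (j : ℕ) (x : X.next.carrier) :
    X.incl (X.next.grading.proj j x) = (extendScalars K sig X.gens).proj j (X.incl x) := rfl

/-- The differential onto the relations between the generators. -/
def diff [Module.Finite K X.next.gens] :
    (Fin (Module.finrank K X.next.gens) → MvPolynomial sig K) →ₗ[MvPolynomial sig K]
      (Fin (Module.finrank K X.gens) → MvPolynomial sig K) :=
  X.coord.toLinearMap ∘ₗ X.incl ∘ₗ X.next.cover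

lemma ker_diff [Module.Finite K X.next.gens] :
    LinearMap.ker X.diff = LinearMap.ker X.next.cover := by
  rw [diff, LinearEquiv.ker_comp, LinearMap.ker_comp_of_ker_eq_bot _ X.ker_incl]

lemma ker_cover [Module.Finite K X.next.gens]
    (h : Function.Surjective (X.next.grading.mult X.next.deg)) :
    LinearMap.ker X.cover = LinearMap.range X.diff := by
  rw [diff, LinearMap.range_comp, LinearMap.range_comp_of_range_eq_top _
    (LinearMap.range_eq_top.2 (X.next.cover_surjective h)), range_incl, cover, LinearMap.ker_comp]
  exact (Submodule.map_equiv_eq_comap_symm X.coord _).symm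

lemma diff_single_isHomogeneous [Module.Finite K X.next.gens]
    (k : Fin (Module.finrank K X.next.gens)) (l : Fin (Module.finrank K X.gens)) :
    (X.diff (Pi.single k 1) l).IsHomogeneous 1 := by
  have h : X.next.grading.proj 1 _ = _ := (Module.finBasis K X.next.gens k).2
  rw [diff, LinearMap.comp_apply, LinearMap.comp_apply, cover_single, ← h, incl_proj]
  exact (X.coord_proj 1 _ l).symm ▸ homogeneousComponent_isHomogeneous 1 _

end GradedMod

/-- An ideal all of whose syzygies are linear has a linear resolution. -/
theorem hasLinearResolution_of_isLinear {K : Type u} {sig : Type v} [Field K]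
    (I : Ideal (MvPolynomial sig K))
    (hI : ∀ j, ∀ f ∈ I, (polynomial K sig).proj j f ∈ I) (q : ℕ)
    (h : ∀ k, IsLinear k ((polynomial K sig).restrict I hI) q) : HasLinearResolution q I := by
  let X : GradedMod K sig := { carrier := I, grading := (polynomial K sig).restrict I hI, deg := q }
  have hX := X.isLinear_syzygy h
  have hfin (i : ℕ) : Module.Finite K (X.syzygy i).gens := (hX i 1).1
  have hfin' (i : ℕ) : Module.Finite K (X.syzygy i).next.gens := hfin (i + 1)
  have hsurj (i : ℕ) := (hX i 1).2.1
  let incl : (X.syzygy 0).carrier →ₗ[MvPolynomial sig K] MvPolynomial sig K := I.subtype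
  have hker : LinearMap.ker incl = ⊥ := I.ker_subtype
  have hrange : LinearMap.range incl = I := I.range_subtype
  have hproj (x) : incl ((X.syzygy 0).grading.proj (X.syzygy 0).deg x) =
    homogeneousComponent q (incl x) := rfl
  refine ⟨fun i => Module.finrank K (X.syzygy i).gens, fun i _ => q + i,
    incl ∘ₗ (X.syzygy 0).cover, fun i => (X.syzygy i).diff,
    ⟨?_, fun k => ?_, fun i k l => Or.inr ⟨1, add_assoc q i 1, ?_⟩, ?_, fun i => ?_⟩,
    fun _ _ => rfl⟩
  · rw [← hrange]
    exact LinearMap.range_comp_of_range_eq_top _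
      (LinearMap.range_eq_top.2 ((X.syzygy 0).cover_surjective (hsurj 0)))
  · have h0 := (Module.finBasis K (X.syzygy 0).gens k).2
    rw [mem_piece] at h0
    have h1 := congrArg incl ((X.syzygy 0).cover_single k)
    rw [← h0, hproj] at h1
    exact h1 ▸ homogeneousComponent_isHomogeneous q _
  · exact (X.syzygy i).diff_single_isHomogeneous k l
  · exact (LinearMap.ker_comp_of_ker_eq_bot _ hker).trans ((X.syzygy 0).ker_cover (hsurj 1))
  · exact (X.syzygy i).ker_diff.trans ((X.syzygy (i + 1)).ker_cover (hsurj (i + 2)))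

end Resolution

end ModuleGrading

section SupportIdeal

universe u v

variable {K : Type u} {sig : Type v} [Field K]

/-- The ideal of polynomials all of whose monomials have support in `U`. -/
def supportIdeal (K : Type u) {sig : Type v} [Field K] (U : UpperSet (Finset sig)) :
    Ideal (MvPolynomial sig K) where
  carrier := {f | ∀ m ∈ f.support, m.support ∈ U}
  add_mem' := by
    classical
    intro f g hf hg m hm
    rcases Finset.mem_union.1 (MvPolynomial.support_add hm) with h | h
    exacts [hf m h, hg m h]
  zero_mem' := by simp
  smul_mem' := by
    classical
    intro g f hf m hm
    obtain ⟨a, -, b, hb, rfl⟩ := Finset.mem_add.1 (MvPolynomial.support_mul _ _ hm)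
    refine U.upper ?_ (hf b hb)
    intro i hi
    rw [Finsupp.mem_support_iff] at hi ⊢
    rw [Finsupp.add_apply]
    lia

lemma mem_supportIdeal {U : UpperSet (Finset sig)} {f : MvPolynomial sig K} :
    f ∈ supportIdeal K U ↔ ∀ m ∈ f.support, m.support ∈ U := Iff.rfl

lemma supportIdeal_mono {U V : UpperSet (Finset sig)} (h : ∀ s ∈ U, s ∈ V) :
    supportIdeal K U ≤ supportIdeal K V := fun _ hf m hm => h _ (hf m hm)

lemma homogeneousComponent_mem_supportIdeal (U : UpperSet (Finset sig)) (j : ℕ) :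
    ∀ f ∈ supportIdeal K U, (ModuleGrading.polynomial K sig).proj j f ∈ supportIdeal K U := by
  intro f hf m hm
  rw [ModuleGrading.polynomial, support_homogeneousComponent] at hm
  exact hf m (Finset.mem_filter.1 hm).1

/-- The grading of `supportIdeal K U` by total degree. -/
def supportGrading (K : Type u) {sig : Type v} [Field K] (U : UpperSet (Finset sig)) :
    ModuleGrading K sig (supportIdeal K U) :=
  (ModuleGrading.polynomial K sig).restrict _ (homogeneousComponent_mem_supportIdeal U)

@[simp]
lemma coe_supportGrading_proj (U : UpperSet (Finset sig)) (j : ℕ) (f : supportIdeal K U) :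
    ((supportGrading K U).proj j f : MvPolynomial sig K) =
      homogeneousComponent j (f : MvPolynomial sig K) := rfl

/-- The ideal attached to `U` has linear syzygies, starting from generators of degree `q`. -/
def IsLinearUpperSet (K : Type u) {sig : Type v} [Field K] (q : ℕ) (U : UpperSet (Finset sig)) :
    Prop :=
  ∀ k, ModuleGrading.IsLinear k (supportGrading K U) q

lemma supportIdeal_sup {U V T : UpperSet (Finset sig)} (hT : ∀ s, s ∈ T ↔ s ∈ U ∨ s ∈ V) :
    supportIdeal K T = supportIdeal K U ⊔ supportIdeal K V := by
  classical
  refine le_antisymm (fun f hf => ?_) (sup_le (supportIdeal_mono fun s hs => (hT s).2 (.inl hs))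
    (supportIdeal_mono fun s hs => (hT s).2 (.inr hs)))
  rw [← f.support_sum_monomial_coeff]
  refine Submodule.sum_mem _ fun m hm => ?_
  have key (W : UpperSet (Finset sig)) (h : m.support ∈ W) :
      monomial m (coeff m f) ∈ supportIdeal K W := by
    intro m' hm'
    rwa [Finset.mem_singleton.1 (support_monomial_subset hm')]
  rcases (hT _).1 (hf m hm) with h | h
  · exact Submodule.mem_sup_left (key U h)
  · exact Submodule.mem_sup_right (key V h)

/-- The inclusion of the intersection of two ideals in their direct sum, with a sign. -/
def interMap {U V W : UpperSet (Finset sig)} (hWU : ∀ s ∈ W, s ∈ U) (hWV : ∀ s ∈ W, s ∈ V) :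
    supportIdeal K W →ₗ[MvPolynomial sig K] supportIdeal K U × supportIdeal K V :=
  (Submodule.inclusion (supportIdeal_mono hWU)).prod
    (-Submodule.inclusion (supportIdeal_mono hWV))

/-- The map from the direct sum of two ideals to their sum. -/
def sumMap {U V T : UpperSet (Finset sig)} (hUT : ∀ s ∈ U, s ∈ T) (hVT : ∀ s ∈ V, s ∈ T) :
    supportIdeal K U × supportIdeal K V →ₗ[MvPolynomial sig K] supportIdeal K T :=
  (Submodule.inclusion (supportIdeal_mono hUT)).coprod
    (Submodule.inclusion (supportIdeal_mono hVT))

section MayerVietoris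

variable {U V W T : UpperSet (Finset sig)}

lemma interMap_proj (hWU : ∀ s ∈ W, s ∈ U) (hWV : ∀ s ∈ W, s ∈ V) (j : ℕ)
    (x : supportIdeal K W) :
    interMap hWU hWV ((supportGrading K W).proj j x) =
      ((supportGrading K U).prod (supportGrading K V)).proj j (interMap hWU hWV x) := by
  refine Prod.ext (Subtype.ext ?_) (Subtype.ext ?_) <;>
    simp [interMap, ModuleGrading.prod]

lemma sumMap_proj (hUT : ∀ s ∈ U, s ∈ T) (hVT : ∀ s ∈ V, s ∈ T) (j : ℕ)
    (x : supportIdeal K U × supportIdeal K V) :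
    sumMap hUT hVT (((supportGrading K U).prod (supportGrading K V)).proj j x) =
      (supportGrading K T).proj j (sumMap hUT hVT x) := by
  apply Subtype.ext
  simp [sumMap, ModuleGrading.prod]

lemma interMap_injective (hWU : ∀ s ∈ W, s ∈ U) (hWV : ∀ s ∈ W, s ∈ V) :
    Function.Injective (interMap (K := K) hWU hWV) := fun _ _ hxy =>
  Submodule.inclusion_injective _ congr(($hxy).1)

lemma sumMap_surjective (hT : ∀ s, s ∈ T ↔ s ∈ U ∨ s ∈ V) :
    Function.Surjective (sumMap (K := K) (fun s hs => (hT s).2 (.inl hs))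
      (fun s hs => (hT s).2 (.inr hs))) := by
  rintro ⟨f, hf⟩
  rw [supportIdeal_sup hT] at hf
  obtain ⟨a, ha, b, hb, rfl⟩ := Submodule.mem_sup.1 hf
  exact ⟨(⟨a, ha⟩, ⟨b, hb⟩), rfl⟩

lemma interMap_sumMap_exact (hWU : ∀ s ∈ W, s ∈ U) (hWV : ∀ s ∈ W, s ∈ V)
    (hW : ∀ s, s ∈ U → s ∈ V → s ∈ W) (hUT : ∀ s ∈ U, s ∈ T) (hVT : ∀ s ∈ V, s ∈ T) :
    Function.Exact (interMap (K := K) hWU hWV) (sumMap hUT hVT) := by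
  rintro ⟨⟨a, ha⟩, ⟨b, hb⟩⟩
  constructor
  · intro h
    have h' : a + b = 0 := congrArg Subtype.val h
    obtain rfl := eq_neg_of_add_eq_zero_right h'
    have hb' : a ∈ supportIdeal K V := by simpa using hb
    exact ⟨⟨a, fun m hm => hW _ (ha m hm) (hb' m hm)⟩, rfl⟩
  · rintro ⟨x, hx⟩
    rw [← hx]
    apply Subtype.ext
    simp [interMap, sumMap]

lemma IsLinearUpperSet.sup {q : ℕ} (hT : ∀ s, s ∈ T ↔ s ∈ U ∨ s ∈ V)
    (hW : ∀ s, s ∈ W ↔ s ∈ U ∧ s ∈ V) (hU : IsLinearUpperSet K q U)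
    (hV : IsLinearUpperSet K q V) (hUV : IsLinearUpperSet K (q + 1) W) :
    IsLinearUpperSet K q T := fun k =>
  ModuleGrading.IsLinear.quotient k
    (interMap (fun s hs => ((hW s).1 hs).1) (fun s hs => ((hW s).1 hs).2)) (sumMap _ _)
    (interMap_proj _ _) (sumMap_proj _ _ q) (interMap_injective _ _)
    (interMap_sumMap_exact _ _ (fun s hs hs' => (hW s).2 ⟨hs, hs'⟩) _ _)
    (sumMap_surjective hT) hUV
    (ModuleGrading.IsLinear.extension k (LinearMap.inl _ _ _) (LinearMap.snd _ _ _)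
      (fun x => by simp [ModuleGrading.prod]) (fun x => rfl) LinearMap.inl_injective
      (fun x => by simp [Prod.ext_iff, eq_comm]) LinearMap.snd_surjective (hU k) (hV k))

lemma IsLinearUpperSet.of_inter_union {q : ℕ} (hT : ∀ s, s ∈ T ↔ s ∈ U ∨ s ∈ V)
    (hW : ∀ s, s ∈ W ↔ s ∈ U ∧ s ∈ V) (hUV : IsLinearUpperSet K q W)
    (hUV' : IsLinearUpperSet K q T) : IsLinearUpperSet K q U := fun k =>
  ModuleGrading.IsLinear.retract k
    (H := (supportGrading K U).prod (supportGrading K V)) (b := q)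
    (LinearMap.inl _ _ _) (LinearMap.fst _ _ _)
    (fun x => by simp [ModuleGrading.prod]) (fun x => rfl) (fun x => rfl)
    (ModuleGrading.IsLinear.extension k
      (interMap (fun s hs => ((hW s).1 hs).1) (fun s hs => ((hW s).1 hs).2)) (sumMap _ _)
      (interMap_proj _ _ q) (sumMap_proj _ _ q) (interMap_injective _ _)
      (interMap_sumMap_exact _ _ (fun s hs hs' => (hW s).2 ⟨hs, hs'⟩) _ _)
      (sumMap_surjective hT) (hUV k) (hUV' k))

end MayerVietoris

lemma homogeneousComponent_X_mul (v : sig) (q : ℕ) (f : MvPolynomial sig K) :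
    homogeneousComponent (q + 1) (X v * f) = X v * homogeneousComponent q f := by
  let := MvPolynomial.gradedAlgebra (σ := sig) (R := K)
  have h := DirectSum.coe_decompose_mul_add_of_left_mem (homogeneousSubmodule sig K)
    (i := 1) (j := q) (b := f) (isHomogeneous_X K v)
  rw [add_comm q]
  exact (decomposition.decompose'_apply _ _).symm.trans
    (h.trans (congrArg (_ * ·) (decomposition.decompose'_apply f q)))

/-- The hypotheses say that `U` does not depend on `v` and that `T` consists of the members of `U`
containing `v`. -/
lemma X_mul_mem_supportIdeal_iff [DecidableEq sig] {U T : UpperSet (Finset sig)} {v : sig}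
    (hv : ∀ s, insert v s ∈ U → s ∈ U) (hT : ∀ s, s ∈ T ↔ v ∈ s ∧ s ∈ U)
    (f : MvPolynomial sig K) : X v * f ∈ supportIdeal K T ↔ f ∈ supportIdeal K U := by
  simp only [mem_supportIdeal, mul_comm (X v), support_mul_X, Finset.mem_map, hT,
    addRightEmbedding_apply, forall_exists_index, and_imp, forall_apply_eq_imp_iff₂]
  refine forall₂_congr fun m hm => ⟨fun h => hv _ (U.upper ?_ h.2), fun h => ⟨?_, U.upper ?_ h⟩⟩
  · intro i hi
    by_cases hiv : i = v
    · simp [hiv]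
    · simpa [Finsupp.single_apply, Ne.symm hiv, hiv] using hi
  · simp
  · intro i hi
    simp only [Finsupp.mem_support_iff, Finsupp.add_apply] at hi ⊢
    lia

lemma X_dvd_of_mem_supportIdeal {T : UpperSet (Finset sig)} {v : sig} (hT : ∀ s ∈ T, v ∈ s)
    {f : MvPolynomial sig K} (hf : f ∈ supportIdeal K T) : X v ∣ f := by
  rw [X_dvd_iff_modMonomial_eq_zero]
  ext m
  by_cases hm : Finsupp.single v 1 ≤ m
  · simp [coeff_modMonomial_of_le _ hm]
  · rw [coeff_modMonomial_of_not_le _ hm, coeff_zero]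
    by_contra hc
    refine hm ?_
    have := hT _ (hf m (mem_support_iff.2 hc))
    rw [Finsupp.mem_support_iff] at this
    rw [Finsupp.single_le_iff]
    lia

/-- Multiplication by a variable, as an isomorphism between ideals. -/
def mulX [DecidableEq sig] {U T : UpperSet (Finset sig)} {v : sig}
    (hv : ∀ s, insert v s ∈ U → s ∈ U) (hT : ∀ s, s ∈ T ↔ v ∈ s ∧ s ∈ U) :
    supportIdeal K U ≃ₗ[MvPolynomial sig K] supportIdeal K T :=
  LinearEquiv.ofBijective
    ((LinearMap.mulLeft (MvPolynomial sig K) (X v : MvPolynomial sig K)).restrict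
      fun f hf => (X_mul_mem_supportIdeal_iff hv hT f).2 hf)
    ⟨fun f g hfg => Subtype.ext (mul_left_cancel₀ (X_ne_zero v) (congrArg Subtype.val hfg)), by
      rintro ⟨f, hf⟩
      obtain ⟨g, rfl⟩ := X_dvd_of_mem_supportIdeal (fun s hs => ((hT s).1 hs).1) hf
      exact ⟨⟨g, (X_mul_mem_supportIdeal_iff hv hT g).1 hf⟩, rfl⟩⟩

lemma coe_mulX [DecidableEq sig] {U T : UpperSet (Finset sig)} {v : sig}
    (hv : ∀ s, insert v s ∈ U → s ∈ U) (hT : ∀ s, s ∈ T ↔ v ∈ s ∧ s ∈ U)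
    (f : supportIdeal K U) :
    (mulX hv hT f : MvPolynomial sig K) = X v * (f : MvPolynomial sig K) := rfl

/-- Multiplication by a variable on which `U` does not depend. -/
lemma IsLinearUpperSet.X_mul [DecidableEq sig] {q : ℕ} {U T : UpperSet (Finset sig)} {v : sig}
    (hv : ∀ s, insert v s ∈ U → s ∈ U) (hT : ∀ s, s ∈ T ↔ v ∈ s ∧ s ∈ U)
    (hU : IsLinearUpperSet K q U) : IsLinearUpperSet K (q + 1) T := by
  have he (f : supportIdeal K U) : mulX hv hT ((supportGrading K U).proj q f) =
      (supportGrading K T).proj (q + 1) (mulX hv hT f) := by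
    apply Subtype.ext
    rw [coe_mulX, coe_supportGrading_proj, coe_supportGrading_proj, coe_mulX,
      homogeneousComponent_X_mul]
  intro k
  refine ModuleGrading.IsLinear.retract k (mulX hv hT).symm.toLinearMap
    (mulX hv hT).toLinearMap (fun x => ?_) he (mulX hv hT).apply_symm_apply (hU k)
  apply (mulX hv hT).injective
  rw [he]
  simp only [LinearEquiv.coe_coe, LinearEquiv.apply_symm_apply]

lemma IsLinearUpperSet.of_empty_mem {U : UpperSet (Finset sig)} (hU : ∅ ∈ U) :
    IsLinearUpperSet K 0 U := by
  rintro (_ | k)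
  · trivial
  have hall (f : MvPolynomial sig K) : f ∈ supportIdeal K U := fun m _ =>
    U.upper (Finset.empty_subset _) hU
  let one : (supportGrading K U).piece 0 := ⟨⟨1, hall 1⟩, Subtype.ext (by
    simp [homogeneousComponent_zero])⟩
  have hone (w : (supportGrading K U).piece 0) : ∃ c : K, c • one = w := by
    refine ⟨coeff 0 (w : supportIdeal K U).1, Subtype.ext (Subtype.ext ?_)⟩
    have hw : homogeneousComponent 0 (w : supportIdeal K U).1 = (w : supportIdeal K U).1 :=
      congrArg Subtype.val w.2
    rw [homogeneousComponent_zero] at hw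
    exact Eq.trans (by simp [one, smul_eq_C_mul]) hw
  have htmul (z : MvPolynomial sig K ⊗[K] (supportGrading K U).piece 0) :
      ∃ s, z = s ⊗ₜ one := by
    induction z with
    | zero => exact ⟨0, (TensorProduct.zero_tmul _ _).symm⟩
    | tmul s w =>
      obtain ⟨c, rfl⟩ := hone w
      exact ⟨c • s, (TensorProduct.smul_tmul c s one).symm⟩
    | add x y hx hy =>
      obtain ⟨s, rfl⟩ := hx
      obtain ⟨t, rfl⟩ := hy
      exact ⟨s + t, (TensorProduct.add_tmul _ _ _).symm⟩
  have hmult (s : MvPolynomial sig K) :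
      ((supportGrading K U).mult 0 (s ⊗ₜ one) : MvPolynomial sig K) = s := by
    simp [one]
  have : Subsingleton ((supportGrading K U).syz 0) := by
    refine subsingleton_of_forall_eq 0 fun z => Subtype.ext ?_
    obtain ⟨s, hs⟩ := htmul z
    have hz := z.2
    rw [LinearMap.mem_ker, hs] at hz
    have h0 := hmult s
    rw [hz] at h0
    rw [hs, ← h0]
    simp
  exact ⟨Module.Finite.of_surjective (LinearMap.toSpanSingleton K _ one) hone,
    fun f => ⟨f.1 ⊗ₜ one, Subtype.ext (hmult f)⟩, ModuleGrading.IsLinear.of_subsingleton _ _ _⟩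

lemma IsLinearUpperSet.of_forall_notMem {U : UpperSet (Finset sig)} (hU : ∀ s, s ∉ U) (q : ℕ) :
    IsLinearUpperSet K q U := by
  have : Subsingleton (supportIdeal K U) := by
    refine subsingleton_of_forall_eq 0 fun f => Subtype.ext ?_
    by_contra hf
    obtain ⟨m, hm⟩ := MvPolynomial.support_nonempty.2 hf
    exact hU _ (f.2 m hm)
  exact fun k => ModuleGrading.IsLinear.of_subsingleton _ _ _

/-- The sets meeting `V` in at least `q` elements. -/
def meetingSets [DecidableEq sig] (V : Finset sig) (q : ℕ) : UpperSet (Finset sig) where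
  carrier := {s | q ≤ (s ∩ V).card}
  upper' := fun _ _ hst hs => le_trans (α := ℕ) hs
    (Finset.card_le_card (Finset.inter_subset_inter_right hst))

@[simp]
lemma mem_meetingSets [DecidableEq sig] {V : Finset sig} {q : ℕ} {s : Finset sig} :
    s ∈ meetingSets V q ↔ q ≤ (s ∩ V).card := Iff.rfl

/-- The upper set of the members of `U` containing `v`. -/
def containing (v : sig) (U : UpperSet (Finset sig)) : UpperSet (Finset sig) where
  carrier := {s | v ∈ s ∧ s ∈ U}
  upper' := fun _ _ hst hs => ⟨hst hs.1, U.upper hst hs.2⟩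

@[simp]
lemma mem_containing {v : sig} {U : UpperSet (Finset sig)} {s : Finset sig} :
    s ∈ containing v U ↔ v ∈ s ∧ s ∈ U := Iff.rfl

lemma IsLinearUpperSet.containing_meetingSets [DecidableEq sig] {V : Finset sig} {q : ℕ} {v : sig}
    (hv : v ∉ V) (h : IsLinearUpperSet K q (meetingSets V q)) :
    IsLinearUpperSet K (q + 1) (containing v (meetingSets V q)) :=
  h.X_mul (v := v) (fun s hs => by simpa [Finset.insert_inter_of_notMem hv] using hs)
    fun _ => Iff.rfl

/-- The ideal of squarefree monomials of degree `q` in a set of variables has linear syzygies. -/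
lemma isLinearUpperSet_meetingSets [DecidableEq sig] (V : Finset sig) (q : ℕ) :
    IsLinearUpperSet K q (meetingSets V q) := by
  induction V using Finset.induction_on generalizing q with
  | empty =>
    cases q with
    | zero => exact .of_empty_mem (by simp)
    | succ q => exact .of_forall_notMem (by simp) _
  | insert v V hv ih =>
    cases q with
    | zero => exact .of_empty_mem (by simp)
    | succ q =>
      refine IsLinearUpperSet.sup (fun s => ?_) (fun s => ?_) (ih (q + 1))
        ((ih q).containing_meetingSets hv) ((ih (q + 1)).containing_meetingSets hv)
      · by_cases hs : v ∈ s
        · have : v ∉ s ∩ V := fun h => hv (Finset.mem_inter.1 h).2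
          simp only [mem_meetingSets, Finset.inter_insert_of_mem hs, mem_containing, hs,
            Finset.card_insert_of_notMem this]
          lia
        · simp [Finset.inter_insert_of_notMem hs, hs]
      · simp only [mem_meetingSets, mem_containing]
        grind

end SupportIdeal

section Clutter

variable {n : ℕ} {K : Type*} [Field K] {C P : Finset (Finset (Fin n))}

/-- The sets of vertices containing a triple that is not a circuit of `C`. -/
def clutterUpper (C : Finset (Finset (Fin n))) : UpperSet (Finset (Fin n)) where
  carrier := {s | ∃ F ⊆ s, F.card = 3 ∧ F ∉ C}
  upper' := fun _ _ hst ⟨F, hF, h⟩ => ⟨F, hF.trans hst, h⟩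

lemma mem_clutterUpper {s : Finset (Fin n)} :
    s ∈ clutterUpper C ↔ ∃ F ⊆ s, F.card = 3 ∧ F ∉ C := Iff.rfl

lemma supportIdeal_clutterUpper (C : Finset (Finset (Fin n))) :
    supportIdeal K (clutterUpper C) = circuitIdeal K (clutterCompl 3 C) := by
  have himage : (fun F : Finset (Fin n) => ∏ i ∈ F, (X i : MvPolynomial (Fin n) K)) ''
        ↑(clutterCompl 3 C) = (fun m => monomial m (1 : K)) ''
        ((fun F : Finset (Fin n) => ∑ i ∈ F, Finsupp.single i 1) '' ↑(clutterCompl 3 C)) := by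
    rw [Set.image_image]
    refine Set.image_congr fun F _ => ?_
    rw [monomial_sum_one]
    rfl
  ext f
  rw [circuitIdeal, himage, mem_ideal_span_monomial_image, mem_supportIdeal]
  refine forall₂_congr fun m _ => ?_
  rw [mem_clutterUpper, Set.exists_mem_image]
  refine exists_congr fun F => ?_
  have hle : (∑ i ∈ F, Finsupp.single i 1 : Fin n →₀ ℕ) ≤ m ↔ F ⊆ m.support := by
    rw [Finsupp.le_def]
    refine forall_congr' fun i => ?_
    rw [Finsupp.finsetSum_apply, Finsupp.mem_support_iff]
    by_cases hi : i ∈ F <;> simp [Finsupp.single_apply, hi, Nat.one_le_iff_ne_zero]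
  simp only [hle, clutterCompl, Finset.coe_sdiff, Set.mem_sdiff, Finset.mem_coe,
    Finset.mem_powersetCard, Finset.subset_univ, true_and]
  tauto

/-- Removing a circuit together with an edge contained in no other circuit preserves linearity. -/
lemma IsLinearUpperSet.of_erase {a b c : Fin n} (hab : a ≠ b) (hac : a ≠ c) (hbc : b ≠ c)
    (hF : {a, b, c} ∈ C) (hfree : ∀ G ∈ C, a ∈ G → b ∈ G → G = {a, b, c})
    (h : IsLinearUpperSet K 3 (clutterUpper (C.erase {a, b, c}))) :
    IsLinearUpperSet K 3 (clutterUpper C) := by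
  have hcard (v : Fin n) (ha : v ≠ a) (hb : v ≠ b) : ({a, b, v} : Finset (Fin n)).card = 3 :=
    Finset.card_eq_three.2 ⟨a, b, v, hab, ha.symm, hb.symm, rfl⟩
  have hlin (V : Finset (Fin n)) (ha : a ∉ V) (hb : b ∉ V) :
      IsLinearUpperSet K 3 (containing a (containing b (meetingSets V 1))) :=
    ((isLinearUpperSet_meetingSets V 1).containing_meetingSets hb).X_mul
      (fun s hs => by simpa [hab.symm, Finset.insert_inter_of_notMem ha] using hs)
      fun _ => Iff.rfl
  have hmem (V s : Finset (Fin n)) : s ∈ containing a (containing b (meetingSets V 1)) ↔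
      a ∈ s ∧ b ∈ s ∧ ∃ v ∈ s, v ∈ V := by
    simp [Finset.one_le_card, Finset.Nonempty]
  refine IsLinearUpperSet.of_inter_union
    (V := containing a (containing b (meetingSets {a, b}ᶜ 1)))
    (W := containing a (containing b (meetingSets {a, b, c}ᶜ 1)))
    (fun s => ?_) (fun s => ?_) (hlin _ (by simp) (by simp)) h
  · rw [hmem]
    constructor
    · rintro ⟨F, hFs, hF3, hFC⟩
      by_cases hFabc : F = {a, b, c}
      · subst hFabc
        exact .inr ⟨hFs (by simp), hFs (by simp), c, hFs (by simp), by simp [hac.symm, hbc.symm]⟩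
      · exact .inl ⟨F, hFs, hF3, fun hC => hFC (Finset.mem_erase.2 ⟨hFabc, hC⟩)⟩
    · rintro (⟨F, hFs, hF3, hFC⟩ | ⟨ha, hb, v, hvs, hv⟩)
      · exact ⟨F, hFs, hF3, fun hC => hFC (Finset.mem_of_mem_erase hC)⟩
      · simp only [Finset.mem_compl, Finset.mem_insert, Finset.mem_singleton, not_or] at hv
        refine ⟨{a, b, v}, by simp [Finset.insert_subset_iff, *], hcard v hv.1 hv.2, fun hC => ?_⟩
        rw [Finset.mem_erase] at hC
        exact hC.1 (hfree _ hC.2 (by simp) (by simp))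
  · rw [hmem, hmem]
    simp only [Finset.mem_compl, Finset.mem_insert, Finset.mem_singleton, not_or]
    constructor
    · rintro ⟨ha, hb, v, hvs, hva, hvb, hvc⟩
      refine ⟨⟨{a, b, v}, by simp [Finset.insert_subset_iff, *], hcard v hva hvb, fun hC => ?_⟩,
        ha, hb, v, hvs, hva, hvb⟩
      have hv : v ∈ ({a, b, c} : Finset (Fin n)) := by
        rw [← hfree _ hC (by simp) (by simp)]
        simp
      simp [hva, hvb, hvc] at hv
    · rintro ⟨⟨F, hFs, hF3, hFC⟩, ha, hb, -⟩
      refine ⟨ha, hb, ?_⟩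
      by_contra! hno
      have hsub : F ⊆ {a, b, c} := fun v hv => by
        have := hno v (hFs hv)
        simp only [Finset.mem_insert, Finset.mem_singleton]
        tauto
      rw [Finset.eq_of_subset_of_card_le hsub (by rw [hF3, hcard c hac.symm hbc.symm])] at hFC
      exact hFC hF

/-- A clutter all of whose nonempty subclutters have an edge in only one circuit is linear. -/
lemma isLinearUpperSet_clutterUpper
    (hC : ∀ D ⊆ C, D.Nonempty → ∃ a b c : Fin n, a ≠ b ∧ a ≠ c ∧ b ≠ c ∧ {a, b, c} ∈ D ∧
      ∀ G ∈ D, a ∈ G → b ∈ G → G = {a, b, c}) :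
    IsLinearUpperSet K 3 (clutterUpper C) := by
  induction C using Finset.strongInduction with
  | H C ih =>
    rcases C.eq_empty_or_nonempty with rfl | hne
    · have : clutterUpper ∅ = meetingSets (Finset.univ : Finset (Fin n)) 3 := by
        ext s
        simp only [SetLike.mem_coe, mem_clutterUpper, mem_meetingSets, Finset.inter_univ,
          Finset.le_card_iff_exists_subset_card, Finset.notMem_empty, not_false_eq_true, and_true]
      rw [this]
      exact isLinearUpperSet_meetingSets _ _
    · obtain ⟨a, b, c, hab, hac, hbc, hF, hfree⟩ := hC C subset_rfl hne
      exact .of_erase hab hac hbc hF hfree (ih _ (Finset.erase_ssubset hF) fun D hD =>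
        hC D (hD.trans (Finset.erase_subset _ _)))

/-- A nonempty proper family of faces of a sphere triangulation has a boundary edge. -/
lemma IsSphereTriangulation.exists_boundary_edge (hP : IsSphereTriangulation P) (hCP : C ⊂ P)
    (hne : C.Nonempty) : ∃ a b c : Fin n, a ≠ b ∧ a ≠ c ∧ b ≠ c ∧ {a, b, c} ∈ C ∧
      ∀ G ∈ C, a ∈ G → b ∈ G → G = {a, b, c} := by
  obtain ⟨hcard, -, hedge, -, hlink, hconn, -⟩ := hP
  by_contra! hno
  have hthird {F : Finset (Fin n)} (hF : F ∈ P) {a b : Fin n} (hab : a ≠ b) (ha : a ∈ F)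
      (hb : b ∈ F) : ∃ c, a ≠ c ∧ b ≠ c ∧ F = {a, b, c} := by
    obtain ⟨c, hc⟩ := Finset.card_eq_one.1 (show ((F.erase a).erase b).card = 1 by
      rw [Finset.card_erase_of_mem (by simp [hab.symm, hb]), Finset.card_erase_of_mem ha,
        hcard F hF])
    have hc' : c ∈ (F.erase a).erase b := by simp [hc]
    simp only [Finset.mem_erase] at hc'
    refine ⟨c, hc'.2.1.symm, hc'.1.symm, ?_⟩
    rw [← hc, Finset.insert_erase (by simp [hab.symm, hb]), Finset.insert_erase ha]
  have hstep {F G : Finset (Fin n)} (hF : F ∈ C) (hG : G ∈ P) {a b : Fin n} (hab : a ≠ b)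
      (haF : a ∈ F) (hbF : b ∈ F) (haG : a ∈ G) (hbG : b ∈ G) : G ∈ C := by
    obtain ⟨c, hac, hbc, rfl⟩ := hthird (hCP.1 hF) hab haF hbF
    obtain ⟨F', hF', haF', hbF', hne'⟩ := hno a b c hab hac hbc hF
    have h2 := hedge {a, b} (Finset.card_pair hab) ⟨_, hG, by simp [Finset.insert_subset_iff, *]⟩
    have heq : ({{a, b, c}, F'} : Finset (Finset (Fin n))) =
        P.filter fun F => {a, b} ⊆ F := by
      refine Finset.eq_of_subset_of_card_le ?_ (by rw [h2, Finset.card_pair hne'.symm])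
      simp [Finset.insert_subset_iff, hCP.1 hF, hCP.1 hF', haF', hbF']
    have : G ∈ ({{a, b, c}, F'} : Finset (Finset (Fin n))) := by
      rw [heq]
      simp [Finset.insert_subset_iff, *]
    rcases by simpa using this with rfl | rfl
    exacts [hF, hF']
  have hstar {F G : Finset (Fin n)} (hF : F ∈ C) (hG : G ∈ P) {v : Fin n} (hvF : v ∈ F)
      (hvG : v ∈ G) : G ∈ C := by
    have hother {H : Finset (Fin n)} (hH : H ∈ P) : ∃ u ∈ H, u ≠ v :=
      Finset.exists_mem_ne (by rw [hcard H hH]; norm_num) v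
    obtain ⟨u, huF, huv⟩ := hother (hCP.1 hF)
    obtain ⟨w, hwG, hwv⟩ := hother hG
    have key : ∃ H ∈ C, v ∈ H ∧ w ∈ H := by
      refine (hlink v u w huv hwv ⟨F, hCP.1 hF, hvF, huF⟩ ⟨G, hG, hvG, hwG⟩).rec
        (motive := fun w _ => w ≠ v → ∃ H ∈ C, v ∈ H ∧ w ∈ H) ?_ ?_ hwv
      · exact fun _ => ⟨F, hF, hvF, huF⟩
      · intro x y _ hxy ih hyv
        by_cases hxv : x = v
        · subst hxv
          have := hcard _ hxy.2
          have := Finset.card_le_two (a := x) (b := y)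
          simp_all
        · obtain ⟨H, hH, hvH, hxH⟩ := ih hxv
          exact ⟨_, hstep hH hxy.2 (Ne.symm hxv) hvH hxH (by simp) (by simp), by simp, by simp⟩
    obtain ⟨H, hH, hvH, hwH⟩ := key
    exact hstep hH hG hwv.symm hvH hwH hvG hwG
  obtain ⟨F, hF⟩ := hne
  obtain ⟨u, hu⟩ := Finset.card_pos.1 (by rw [hcard F (hCP.1 hF)]; norm_num)
  have hcover (w : Fin n) : ∃ H ∈ C, w ∈ H := by
    induction hconn u w with
    | refl => exact ⟨F, hF, hu⟩
    | tail _ hxy ih =>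
      obtain ⟨H, hH, hxH⟩ := ih
      obtain ⟨-, G, hG, hxG, hyG⟩ := hxy
      exact ⟨G, hstar hH hG hxH hxG, hyG⟩
  refine hCP.2 fun G hG => ?_
  obtain ⟨w, hw⟩ := Finset.card_pos.1 (by rw [hcard G hG]; norm_num)
  obtain ⟨H, hH, hwH⟩ := hcover w
  exact hstar hH hG hwH hw

end Clutter

/-- Let `𝔓ₙ` be the 3-uniform clutter of the triangular faces of a
triangulation of the 2-sphere on `n ≥ 5` vertices.  For any proper subclutter
`C₁ ⊊ 𝔓ₙ`, the circuit ideal `I(C̄₁)` has a 3-linear resolution. -/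
theorem proper_subclutter_of_sphere_linear {K : Type*} [Field K] (n : ℕ) (hn : 5 ≤ n)
    (P : Finset (Finset (Fin n))) (hP : IsSphereTriangulation P)
    (C₁ : Finset (Finset (Fin n))) (hsub : C₁ ⊂ P) :
    HasLinearResolution 3 (circuitIdeal K (clutterCompl 3 C₁)) := by
  rw [← supportIdeal_clutterUpper]
  exact ModuleGrading.hasLinearResolution_of_isLinear _
    (homogeneousComponent_mem_supportIdeal _) 3 (isLinearUpperSet_clutterUpper
      fun D hD => hP.exists_boundary_edge (hD.trans_ssubset hsub))
end
end

section
/- Let 𝔓_n be the 3-uniform clutter on n ≥ 5 vertices whose circuits are the triangular faces of a triangulation of the 2-sphere, and let I = I(𝔓̄_n) ⊆ K[x_1,…,x_n] be the circuit ideal of the complement of 𝔓_n. Then I does not have a 3-linear resolution. -/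
open MvPolynomial

noncomputable section

/-- The sign `(-1)^#{k ∈ T : k < j}` with which `j` enters the ordered set `T`. -/
def koszulSign (R : Type*) [CommRing R] {n : ℕ} (j : Fin n) (T : Finset (Fin n)) : R :=
  (-1) ^ (T.filter (· < j)).card

lemma koszulSign_mul_self (R : Type*) [CommRing R] {n : ℕ} (j : Fin n) (T : Finset (Fin n)) :
    koszulSign R j T * koszulSign R j T = 1 := by
  rw [koszulSign, ← mul_pow]
  simp

lemma koszulSign_anticomm (R : Type*) [CommRing R] {n : ℕ} {j k : Fin n} {T : Finset (Fin n)}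
    (hj : j ∉ T) (hk : k ∉ T) (hjk : j ≠ k) :
    koszulSign R j T * koszulSign R k (insert j T) =
      -(koszulSign R k T * koszulSign R j (insert k T)) := by
  rcases lt_or_gt_of_ne hjk with h | h
  · simp only [koszulSign, Finset.filter_insert, h, if_true, h.not_gt, if_false]
    rw [Finset.card_insert_of_notMem (by simp [hj])]
    ring
  · simp only [koszulSign, Finset.filter_insert, h, if_true, h.not_gt, if_false]
    rw [Finset.card_insert_of_notMem (by simp [hk])]
    ring

/-- The Koszul differential of the sequence `x` with coefficients in `M`; an element of the
(total) Koszul complex is given by its coordinates with respect to the basis `e_T`. -/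
def koszulD {R : Type*} [CommRing R] {n : ℕ} (x : Fin n → R) (M : Type*) [AddCommGroup M]
    [Module R M] : (Finset (Fin n) → M) →ₗ[R] (Finset (Fin n) → M) where
  toFun m T := ∑ j ∈ Tᶜ, (koszulSign R j T * x j) • m (insert j T)
  map_add' m m' := by
    ext T
    simp [Finset.sum_add_distrib]
  map_smul' r m := by
    ext T
    simp only [Pi.smul_apply, RingHom.id_apply, Finset.smul_sum]
    exact Finset.sum_congr rfl fun j _ => smul_comm _ _ _

lemma koszulD_apply {R : Type*} [CommRing R] {n : ℕ} (x : Fin n → R) {M : Type*} [AddCommGroup M]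
    [Module R M] (m : Finset (Fin n) → M) (T : Finset (Fin n)) :
    koszulD x M m T = ∑ j ∈ Tᶜ, (koszulSign R j T * x j) • m (insert j T) := rfl

lemma koszulD_koszulD {R : Type*} [CommRing R] {n : ℕ} (x : Fin n → R) {M : Type*}
    [AddCommGroup M] [Module R M] (m : Finset (Fin n) → M) :
    koszulD x M (koszulD x M m) = 0 := by
  ext T
  simp only [koszulD_apply, Finset.smul_sum, Pi.zero_apply]
  rw [Finset.sum_sigma']
  refine Finset.sum_involution (fun a _ => ⟨a.2, a.1⟩) ?_ ?_ ?_ ?_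
  · rintro ⟨j, k⟩ h
    simp only [Finset.mem_sigma, Finset.mem_compl, Finset.mem_insert, not_or] at h
    obtain ⟨hj, hkj, hk⟩ := h
    rw [smul_smul, smul_smul, Finset.insert_comm k j, ← add_smul]
    have := koszulSign_anticomm R hj hk (Ne.symm hkj)
    convert zero_smul R _
    linear_combination (x j * x k) * this
  · rintro ⟨j, k⟩ h _ heq
    simp only [Finset.mem_sigma, Finset.mem_compl, Finset.mem_insert, not_or] at h
    simp only [Sigma.mk.injEq] at heq
    exact h.2.1 heq.1
  · rintro ⟨j, k⟩ h
    simp only [Finset.mem_sigma, Finset.mem_compl, Finset.mem_insert, not_or] at h ⊢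
    tauto
  · rintro ⟨j, k⟩ h
    rfl

lemma koszulD_comp {R : Type*} [CommRing R] {n : ℕ} (x : Fin n → R) {M N : Type*}
    [AddCommGroup M] [Module R M] [AddCommGroup N] [Module R N] (f : M →ₗ[R] N)
    (m : Finset (Fin n) → M) :
    koszulD x N (fun T => f (m T)) = fun T => f (koszulD x M m T) := by
  ext T
  simp [koszulD_apply]

lemma exists_coeff_eq_ite {σ K : Type*} [Field K] (p : MvPolynomial σ K) (Q : (σ →₀ ℕ) → Prop)
    [DecidablePred Q] :
    ∃ q : MvPolynomial σ K, ∀ a, coeff a q = if Q a then coeff a p else 0 := by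
  classical
  refine ⟨∑ a ∈ p.support, if Q a then monomial a (coeff a p) else 0, fun a => ?_⟩
  rw [coeff_sum, Finset.sum_eq_single a]
  · split_ifs <;> simp
  · intro b _ hb
    split_ifs <;> simp [coeff_monomial, hb]
  · intro ha
    rw [notMem_support_iff] at ha
    split_ifs <;> simp [ha]

lemma coeff_koszulD {n : ℕ} {K : Type*} [Field K] (m : Finset (Fin n) → MvPolynomial (Fin n) K)
    (T : Finset (Fin n)) (a : Fin n →₀ ℕ) :
    coeff a (koszulD (X (R := K)) (MvPolynomial (Fin n) K) m T) =
      ∑ j ∈ Tᶜ, if a j = 0 then 0 else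
        koszulSign K j T * coeff (a - Finsupp.single j 1) (m (insert j T)) := by
  rw [koszulD_apply, coeff_sum]
  refine Finset.sum_congr rfl fun j _ => ?_
  have : (koszulSign (MvPolynomial (Fin n) K) j T) = C (koszulSign K j T) := by
    simp [koszulSign]
  rw [this, C_mul_X_eq_monomial, smul_eq_mul, coeff_monomial_mul']
  simp only [Finsupp.single_le_iff, Nat.one_le_iff_ne_zero, ite_not]

/-- The Koszul complex of the variables over the polynomial ring is acyclic: contract the part of
multidegree `u ≠ 0` along the least variable of `u`. -/
lemma exists_koszulD_eq {n : ℕ} {K : Type*} [Field K]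
    (m : Finset (Fin n) → MvPolynomial (Fin n) K)
    (hm : koszulD (X (R := K)) (MvPolynomial (Fin n) K) m = 0) (h0 : coeff 0 (m ∅) = 0) :
    ∃ w, koszulD (X (R := K)) (MvPolynomial (Fin n) K) w = m := by
  classical
  have key : ∀ T : Finset (Fin n), ∃ q : MvPolynomial (Fin n) K, ∀ a, coeff a q =
      ∑ j ∈ T, if ∀ k < j, k ∉ T ∧ a k = 0 then
        koszulSign K j (T.erase j) * coeff (a + Finsupp.single j 1) (m (T.erase j)) else 0 := by
    intro T
    have : ∀ j, ∃ q : MvPolynomial (Fin n) K, ∀ a, coeff a q =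
      if ∀ k < j, k ∉ T ∧ a k = 0 then
        koszulSign K j (T.erase j) * coeff (a + Finsupp.single j 1) (m (T.erase j)) else 0 := by
      intro j
      obtain ⟨q, hq⟩ := exists_coeff_eq_ite
        (C (koszulSign K j (T.erase j)) * divMonomial (m (T.erase j)) (Finsupp.single j 1))
        (fun a => ∀ k < j, k ∉ T ∧ a k = 0)
      refine ⟨q, fun a => ?_⟩
      rw [hq, coeff_C_mul, coeff_divMonomial, add_comm]
    choose q hq using this
    exact ⟨∑ j ∈ T, q j, fun a => by simp [coeff_sum, hq]⟩
  choose w hw using key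
  refine ⟨w, ?_⟩
  ext T a
  rw [coeff_koszulD]
  by_cases hu : ∃ j, j ∈ T ∨ a j ≠ 0
  swap
  · push Not at hu
    obtain rfl : T = ∅ := Finset.eq_empty_of_forall_notMem fun j => (hu j).1
    obtain rfl : a = 0 := Finsupp.ext fun j => (hu j).2
    simp [h0]
  obtain ⟨j, hj, hmin⟩ : ∃ j, (j ∈ T ∨ a j ≠ 0) ∧ ∀ k < j, k ∉ T ∧ a k = 0 := by
    let s : Finset (Fin n) := Finset.univ.filter fun j => j ∈ T ∨ a j ≠ 0
    have hs : s.Nonempty := by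
      obtain ⟨j, hj⟩ := hu
      exact ⟨j, by simpa [s] using hj⟩
    refine ⟨s.min' hs, by simpa [s] using s.min'_mem hs, fun k hk => ?_⟩
    by_contra hc
    have : k ∈ s := by
      simp only [s, Finset.mem_filter, Finset.mem_univ, true_and]
      tauto
    exact absurd (s.min'_le k this) (not_le.2 hk)
  -- the value of the contraction in the multidegree of `(T, a)`
  have hval : ∀ k ∉ T, a k ≠ 0 → coeff (a - Finsupp.single k 1) (w (insert k T)) =
      if j ∈ insert k T then koszulSign K j ((insert k T).erase j) *
        coeff (a - Finsupp.single k 1 + Finsupp.single j 1) (m ((insert k T).erase j)) else 0 := by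
    intro k hk hak
    have hjk : j ≤ k := not_lt.1 fun h => hak (hmin k h).2
    rw [hw]
    split_ifs with hjm
    · rw [Finset.sum_eq_single_of_mem j hjm, if_pos]
      · intro l hl
        have := hmin l hl
        refine ⟨?_, by simp [this.2]⟩
        rw [Finset.mem_insert, not_or]
        exact ⟨(hl.trans_le hjk).ne, this.1⟩
      · intro l hl hlj
        refine if_neg fun h => ?_
        rcases lt_or_gt_of_ne hlj with h' | h'
        · rcases Finset.mem_insert.1 hl with rfl | hl'
          · exact absurd h' (not_lt.2 hjk)
          · exact (hmin l h').1 hl'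
        · exact (h j h').1 hjm
    · refine Finset.sum_eq_zero fun l hl => if_neg fun h => ?_
      have hjl : j ≤ l := by
        rcases Finset.mem_insert.1 hl with rfl | hl'
        · exact hjk
        · exact not_lt.1 fun h => (hmin l h).1 hl'
      have hjl' : j < l := lt_of_le_of_ne hjl (by rintro rfl; exact hjm hl)
      have h2 := (h j hjl').2
      have hkj : k ≠ j := by rintro rfl; simp at hjm
      have haj : a j ≠ 0 := hj.resolve_left fun h => hjm (Finset.mem_insert_of_mem h)
      simp [hkj, haj] at h2
  by_cases hjT : j ∈ T
  · have hc : coeff (a + Finsupp.single j 1)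
        (koszulD (X (R := K)) (MvPolynomial (Fin n) K) m (T.erase j)) = 0 := by
      rw [hm]; simp
    rw [coeff_koszulD, Finset.compl_erase, Finset.sum_insert (by simpa using hjT),
      Finset.insert_erase hjT, add_tsub_cancel_right, if_neg (by simp)] at hc
    have hsum : (∑ k ∈ Tᶜ, if a k = 0 then 0 else
        koszulSign K k T * coeff (a - Finsupp.single k 1) (w (insert k T))) =
        -koszulSign K j (T.erase j) * ∑ k ∈ Tᶜ,
        (if (a + Finsupp.single j 1 : Fin n →₀ ℕ) k = 0 then 0 else
        koszulSign K k (T.erase j) * coeff (a + Finsupp.single j 1 - Finsupp.single k 1)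
          (m (insert k (T.erase j)))) := by
      rw [Finset.mul_sum]
      refine Finset.sum_congr rfl fun k hk => ?_
      rw [Finset.mem_compl] at hk
      have hkj : k ≠ j := by rintro rfl; exact hk hjT
      have e1 : (a + Finsupp.single j 1 : Fin n →₀ ℕ) k = a k := by simp [hkj]
      rw [e1]
      split_ifs with hak
      · simp
      rw [hval k hk hak, if_pos (Finset.mem_insert_of_mem hjT)]
      have e2 : (insert k T).erase j = insert k (T.erase j) := by
        rw [Finset.erase_insert_of_ne hkj]
      have e3 : a - Finsupp.single k 1 + Finsupp.single j 1 =
          a + Finsupp.single j 1 - Finsupp.single k 1 := by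
        ext l
        simp only [Finsupp.add_apply, Finsupp.tsub_apply, Finsupp.single_apply]
        by_cases h1 : k = l
        · subst h1
          simp [hkj.symm]
        · simp [h1]
      have hs := koszulSign_anticomm K (Finset.notMem_erase j T)
        (fun h => hk (Finset.mem_of_mem_erase h)) hkj.symm
      rw [Finset.insert_erase hjT] at hs
      have hsq := koszulSign_mul_self K j (T.erase j)
      have hs' : koszulSign K k T * koszulSign K j (insert k (T.erase j)) =
          -koszulSign K j (T.erase j) * koszulSign K k (T.erase j) := by
        have hsq' := koszulSign_mul_self K j (insert k (T.erase j))
        set A := koszulSign K j (T.erase j)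
        set B := koszulSign K k T
        set A' := koszulSign K j (insert k (T.erase j))
        set B' := koszulSign K k (T.erase j)
        linear_combination (A * A') * hs - B * A' * hsq - A * B' * hsq'
      rw [e2, e3, ← mul_assoc, hs', mul_assoc]
    rw [hsum]
    have hsq := koszulSign_mul_self K j (T.erase j)
    linear_combination (-koszulSign K j (T.erase j)) * hc + coeff a (m T) * hsq
  · have haj : a j ≠ 0 := hj.resolve_left hjT
    rw [Finset.sum_eq_single_of_mem j (by simpa using hjT)]
    · rw [if_neg haj, hval j hjT haj, if_pos (Finset.mem_insert_self _ _),
        Finset.erase_insert hjT, ← mul_assoc, koszulSign_mul_self, one_mul]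
      congr 1
      ext l
      simp only [Finsupp.add_apply, Finsupp.tsub_apply, Finsupp.single_apply]
      split_ifs with h
      · subst h; omega
      · simp
    · intro k hk hkj
      split_ifs with hak
      · rfl
      · rw [hval k (by simpa using hk) hak, if_neg (by simp [hjT, hkj.symm]), mul_zero]

lemma exists_koszulD_pi_eq {n c : ℕ} {K : Type*} [Field K]
    (m : Finset (Fin n) → Fin c → MvPolynomial (Fin n) K)
    (hm : koszulD (X (R := K)) (Fin c → MvPolynomial (Fin n) K) m = 0)
    (h0 : ∀ l, coeff 0 (m ∅ l) = 0) :
    ∃ w, koszulD (X (R := K)) (Fin c → MvPolynomial (Fin n) K) w = m := by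
  have (l : Fin c) : ∃ w, koszulD (X (R := K)) (MvPolynomial (Fin n) K) w = fun T => m T l := by
    refine exists_koszulD_eq _ ?_ (h0 l)
    have := koszulD_comp (X (R := K)) (LinearMap.proj (R := MvPolynomial (Fin n) K)
      (φ := fun _ : Fin c => MvPolynomial (Fin n) K) l) m
    simp only [LinearMap.proj_apply] at this
    rw [this, hm]
    rfl
  choose w hw using this
  refine ⟨fun T l => w l T, ?_⟩
  ext1 T
  ext1 l
  rw [← congrFun (hw l) T]
  simp [koszulD_apply]

lemma homogeneousComponent_mul_of_isHomogeneous {σ K : Type*} [Field K] (p : MvPolynomial σ K)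
    {q : MvPolynomial σ K} {e : ℕ} (hq : q.IsHomogeneous e) (i : ℕ) :
    homogeneousComponent (i + e) (p * q) = homogeneousComponent i p * q := by
  have hk (k : ℕ) : homogeneousComponent (i + e) (homogeneousComponent k p * q) =
      if i = k then homogeneousComponent k p * q else 0 := by
    rw [homogeneousComponent_of_mem ((homogeneousComponent_isHomogeneous k p).mul hq)]
    simp
  conv_lhs => rw [← sum_homogeneousComponent p, Finset.sum_mul, map_sum]
  simp only [hk, Finset.sum_ite_eq, Finset.mem_range]
  split_ifs with h
  · rfl
  · rw [homogeneousComponent_eq_zero _ _ (by omega), zero_mul]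

lemma LinearMap.apply_eq_sum_mul {S : Type*} [CommRing S] {c : ℕ} (f : (Fin c → S) →ₗ[S] S)
    (v : Fin c → S) : f v = ∑ k, v k * f (Pi.single k 1) := by
  conv_lhs => rw [pi_eq_sum_univ' v, map_sum]
  refine Finset.sum_congr rfl fun k _ => ?_
  rw [map_smul, smul_eq_mul]

/-- A linear form with homogeneous entries of degree `e` commutes with homogeneous components. -/
lemma homogeneousComponent_linearMap_apply {σ K : Type*} [Field K] {c e : ℕ}
    (f : (Fin c → MvPolynomial σ K) →ₗ[MvPolynomial σ K] MvPolynomial σ K)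
    (hf : ∀ k, (f (Pi.single k 1)).IsHomogeneous e) (v : Fin c → MvPolynomial σ K) (i : ℕ) :
    homogeneousComponent (i + e) (f v) = f fun k => homogeneousComponent i (v k) := by
  rw [f.apply_eq_sum_mul v, f.apply_eq_sum_mul, map_sum]
  exact Finset.sum_congr rfl fun k _ => homogeneousComponent_mul_of_isHomogeneous _ (hf k) i

lemma exists_eq_sum_X_mul {n : ℕ} {K : Type*} [Field K] {p : MvPolynomial (Fin n) K}
    (hp : coeff 0 p = 0) : ∃ c : Fin n → MvPolynomial (Fin n) K, p = ∑ j, X j * c j := by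
  have : p ∈ Ideal.span (Set.range (X : Fin n → MvPolynomial (Fin n) K)) := by
    rw [← Set.image_univ, mem_ideal_span_X_image]
    intro m hm
    by_contra! h
    obtain rfl : m = 0 := Finsupp.ext fun i => h i (Set.mem_univ i)
    exact (mem_support_iff.1 hm) hp
  obtain ⟨c, hc⟩ := Ideal.mem_span_range_iff_exists_fun.1 this
  exact ⟨c, by rw [← hc]; exact Finset.sum_congr rfl fun _ _ => mul_comm _ _⟩

lemma MvPolynomial.IsHomogeneous.coeff_zero_eq_zero {σ K : Type*} [Field K]
    {p : MvPolynomial σ K} {e : ℕ} (hp : p.IsHomogeneous e) (he : e ≠ 0) : coeff 0 p = 0 :=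
  hp.coeff_eq_zero (by simpa using he.symm)

/-- Every Koszul cycle of exterior degree at most `i` whose coefficients are images under `D` of
vectors of linear forms is the boundary of a chain with coefficients in the range of `D`. -/
def KoszulLinearlyExact {n b : ℕ} {K : Type*} [Field K] {N : Type*} [AddCommGroup N]
    [Module (MvPolynomial (Fin n) K) N] (i : ℕ)
    (D : (Fin b → MvPolynomial (Fin n) K) →ₗ[MvPolynomial (Fin n) K] N) : Prop :=
  ∀ η : Finset (Fin n) → N, koszulD (X (R := K)) N η = 0 → (∀ T, i < T.card → η T = 0) →
    (∀ T, ∃ v, (∀ l, (v l).IsHomogeneous 1) ∧ D v = η T) →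
    ∃ θ : Finset (Fin n) → Fin b → MvPolynomial (Fin n) K,
      koszulD (X (R := K)) N (fun T => D (θ T)) = η

lemma koszulLinearlyExact_zero {n b : ℕ} {K : Type*} [Field K] {N : Type*} [AddCommGroup N]
    [Module (MvPolynomial (Fin n) K) N]
    (D : (Fin b → MvPolynomial (Fin n) K) →ₗ[MvPolynomial (Fin n) K] N) :
    KoszulLinearlyExact 0 D := by
  intro η _ hsupp hη
  obtain ⟨v, hv, hvη⟩ := hη ∅
  choose c hc using fun l => exists_eq_sum_X_mul ((hv l).coeff_zero_eq_zero one_ne_zero)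
  refine ⟨fun T => ∑ j, if T = {j} then fun l => c l j else 0, ?_⟩
  ext1 T
  rw [koszulD_apply]
  by_cases hT : T = ∅
  · subst hT
    have hv' : v = ∑ j, (X j : MvPolynomial (Fin n) K) • fun l => c l j := by
      ext1 l
      simp [hc l]
    rw [← hvη, hv', map_sum, Finset.compl_empty]
    refine Finset.sum_congr rfl fun j _ => ?_
    rw [map_smul]
    simp [koszulSign]
  · rw [hsupp T (Finset.card_pos.2 (Finset.nonempty_iff_ne_empty.2 hT))]
    refine Finset.sum_eq_zero fun j hj => ?_
    convert smul_zero _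
    convert map_zero D
    refine Finset.sum_eq_zero fun k _ => if_neg fun h => ?_
    have h1 := congrArg Finset.card h
    rw [Finset.card_insert_of_notMem (Finset.mem_compl.1 hj)] at h1
    simp at h1
    exact hT h1

lemma koszulLinearlyExact_succ {n b b' : ℕ} {K : Type*} [Field K] {N : Type*} [AddCommGroup N]
    [Module (MvPolynomial (Fin n) K) N] {i : ℕ}
    {D : (Fin b → MvPolynomial (Fin n) K) →ₗ[MvPolynomial (Fin n) K] N}
    {D' : (Fin b' → MvPolynomial (Fin n) K) →ₗ[MvPolynomial (Fin n) K]
      (Fin b → MvPolynomial (Fin n) K)}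
    (hD' : ∀ k l, (D' (Pi.single k 1) l).IsHomogeneous 1)
    (hex : LinearMap.ker D = LinearMap.range D') (h : KoszulLinearlyExact i D') :
    KoszulLinearlyExact (i + 1) D := by
  classical
  intro η hcyc hsupp hη
  have hcomp (l : Fin b) (k) :
      ((LinearMap.proj l ∘ₗ D') (Pi.single k 1)).IsHomogeneous 1 := hD' k l
  have : ∀ T, ∃ v, (∀ l, (v l).IsHomogeneous 1) ∧ D v = η T ∧ (i + 1 < T.card → v = 0) := by
    intro T
    by_cases hT : i + 1 < T.card
    · exact ⟨0, fun l => isHomogeneous_zero _ _ _, by rw [hsupp T hT, map_zero], fun _ => rfl⟩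
    · obtain ⟨v, hv, hvη⟩ := hη T
      exact ⟨v, hv, hvη, fun h => absurd h hT⟩
  choose v hv hvη hvsupp using this
  have hDv : (fun T => D (v T)) = η := funext hvη
  obtain ⟨θ', hθ'⟩ := h (koszulD (X (R := K)) _ v) (koszulD_koszulD _ _) (by
    intro T hT
    rw [koszulD_apply]
    refine Finset.sum_eq_zero fun j hj => ?_
    rw [hvsupp, smul_zero]
    rw [Finset.card_insert_of_notMem (Finset.mem_compl.1 hj)]
    omega) (by
    intro T
    have hker : koszulD (X (R := K)) _ v T ∈ LinearMap.ker D := by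
      have := congrFun (koszulD_comp (X (R := K)) D v) T
      rw [hDv, hcyc] at this
      exact this.symm
    rw [hex] at hker
    obtain ⟨u, hu⟩ := hker
    refine ⟨fun k => homogeneousComponent 1 (u k),
      fun k => homogeneousComponent_isHomogeneous _ _, ?_⟩
    rw [← hu]
    ext1 l
    have h2 : (D' u l).IsHomogeneous 2 := by
      rw [hu, koszulD_apply, Finset.sum_apply]
      refine IsHomogeneous.sum _ _ _ fun j _ => ?_
      have hs : (koszulSign (MvPolynomial (Fin n) K) j T) = C (koszulSign K j T) := by
        simp [koszulSign]
      rw [hs, Pi.smul_apply, smul_eq_mul]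
      exact ((isHomogeneous_C_mul_X _ _).mul (hv _ l))
    have := homogeneousComponent_linearMap_apply (LinearMap.proj l ∘ₗ D') (hcomp l) u 1
    simp only [LinearMap.comp_apply, LinearMap.proj_apply] at this
    rw [← this, homogeneousComponent_eq_self h2])
  obtain ⟨w, hw⟩ := exists_koszulD_pi_eq (v - fun T => D' (θ' T))
    (by rw [map_sub, hθ', sub_self]) (by
      intro l
      have : coeff 0 (D' (θ' ∅) l) = 0 := by
        have h0 := (LinearMap.proj l ∘ₗ D').apply_eq_sum_mul (θ' ∅)
        simp only [LinearMap.comp_apply, LinearMap.proj_apply] at h0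
        rw [h0, coeff_sum]
        refine Finset.sum_eq_zero fun k _ => ?_
        rw [← constantCoeff_eq, map_mul, constantCoeff_eq,
          (hD' k l).coeff_zero_eq_zero one_ne_zero, mul_zero]
      simp [this, (hv ∅ l).coeff_zero_eq_zero one_ne_zero])
  refine ⟨w, ?_⟩
  rw [koszulD_comp, hw, ← hDv]
  ext1 T
  have : D' (θ' T) ∈ LinearMap.ker D := hex ▸ LinearMap.mem_range_self _ _
  simp [LinearMap.mem_ker.1 this]

lemma IsGradedFreeResolution.koszulLinearlyExact {n q : ℕ} {K : Type*} [Field K]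
    {I : Ideal (MvPolynomial (Fin n) K)} {b : ℕ → ℕ} {deg : (i : ℕ) → Fin (b i) → ℕ}
    {aug : (Fin (b 0) → MvPolynomial (Fin n) K) →ₗ[MvPolynomial (Fin n) K]
      MvPolynomial (Fin n) K}
    {d : (i : ℕ) → ((Fin (b (i + 1)) → MvPolynomial (Fin n) K) →ₗ[MvPolynomial (Fin n) K]
      (Fin (b i) → MvPolynomial (Fin n) K))}
    (h : IsGradedFreeResolution I b deg aug d) (hdeg : ∀ i k, deg i k = q + i) (i : ℕ) :
    KoszulLinearlyExact i aug := by
  obtain ⟨-, -, hhom, hex0, hex⟩ := h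
  have hlin (i k l) : (d i (Pi.single k 1) l).IsHomogeneous 1 := by
    rcases hhom i k l with h0 | ⟨e, he, h1⟩
    · rw [h0]
      exact isHomogeneous_zero _ _ _
    · obtain rfl : e = 1 := by
        rw [hdeg, hdeg] at he
        omega
      exact h1
  have hd : ∀ i k, KoszulLinearlyExact i (d k) := by
    intro i
    induction i with
    | zero => exact fun k => koszulLinearlyExact_zero _
    | succ i ih => exact fun k => koszulLinearlyExact_succ (hlin _) (hex k) (ih _)
  cases i with
  | zero => exact koszulLinearlyExact_zero _
  | succ i => exact koszulLinearlyExact_succ (hlin _) hex0 (hd _ _)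

/-- If `I` has a `q`-linear resolution, a Koszul cycle with coefficients in `I` homogeneous of
degree `q + 1` bounds in the Koszul complex of `I`. -/
lemma HasLinearResolution.exists_koszulD_eq {n q : ℕ} {K : Type*} [Field K]
    {I : Ideal (MvPolynomial (Fin n) K)} (h : HasLinearResolution q I)
    {η : Finset (Fin n) → MvPolynomial (Fin n) K}
    (hη : koszulD (X (R := K)) (MvPolynomial (Fin n) K) η = 0) (hI : ∀ T, η T ∈ I)
    (hdeg : ∀ T, (η T).IsHomogeneous (1 + q)) :
    ∃ ξ, (∀ T, ξ T ∈ I) ∧ koszulD (X (R := K)) (MvPolynomial (Fin n) K) ξ = η := by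
  obtain ⟨b, deg, aug, d, hres, hq⟩ := h
  have haug (k) : (aug (Pi.single k 1)).IsHomogeneous q := by
    have := hres.2.1 k
    rwa [hq] at this
  obtain ⟨θ, hθ⟩ := hres.koszulLinearlyExact hq n η hη
    (fun T hT => absurd T.card_le_univ (by simpa using hT)) (by
      intro T
      obtain ⟨u, hu⟩ : η T ∈ LinearMap.range aug := hres.1 ▸ hI T
      refine ⟨fun k => homogeneousComponent 1 (u k),
        fun k => homogeneousComponent_isHomogeneous _ _, ?_⟩
      rw [← homogeneousComponent_linearMap_apply aug haug u 1, hu,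
        homogeneousComponent_eq_self (hdeg T)])
  exact ⟨fun T => aug (θ T), fun T => hres.1 ▸ LinearMap.mem_range_self _ _, hθ⟩

/-- The exponent vector of the squarefree monomial `x_F`. -/
def finsetExponent {n : ℕ} (F : Finset (Fin n)) : Fin n →₀ ℕ := ∑ i ∈ F, Finsupp.single i 1

lemma finsetExponent_apply {n : ℕ} (F : Finset (Fin n)) (a : Fin n) :
    finsetExponent F a = if a ∈ F then 1 else 0 := by
  simp [finsetExponent, Finsupp.finsetSum_apply, Finsupp.single_apply]

lemma finsetExponent_le_iff {n : ℕ} {F G : Finset (Fin n)} :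
    finsetExponent F ≤ finsetExponent G ↔ F ⊆ G := by
  refine ⟨fun h a ha => ?_, fun h a => ?_⟩
  · by_contra hG
    have := h a
    simp [finsetExponent_apply, ha, hG] at this
  · simp only [finsetExponent_apply]
    split_ifs with h1 h2 <;> simp
    exact h2 (h h1)

lemma finsetExponent_sub_single {n : ℕ} {F : Finset (Fin n)} {j : Fin n} :
    finsetExponent F - Finsupp.single j 1 = finsetExponent (F.erase j) := by
  ext a
  simp only [Finsupp.tsub_apply, finsetExponent_apply, Finsupp.single_apply, Finset.mem_erase]
  by_cases h : j = a
  · subst h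
    split_ifs <;> simp_all
  · simp [h, Ne.symm h]

lemma single_add_finsetExponent {n : ℕ} {F : Finset (Fin n)} {j : Fin n} (hj : j ∉ F) :
    Finsupp.single j 1 + finsetExponent F = finsetExponent (insert j F) := by
  rw [finsetExponent, finsetExponent, Finset.sum_insert hj]

lemma mem_circuitIdeal_iff {n : ℕ} {K : Type*} [Field K] {C : Finset (Finset (Fin n))}
    {p : MvPolynomial (Fin n) K} :
    p ∈ circuitIdeal K C ↔ ∀ a ∈ p.support, ∃ F ∈ C, finsetExponent F ≤ a := by
  have : circuitIdeal K C = Ideal.span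
      ((fun s => monomial s (1 : K)) '' (finsetExponent '' (C : Set (Finset (Fin n))))) := by
    rw [circuitIdeal, Set.image_image]
    congr 2
    ext1 F
    rw [finsetExponent, monomial_sum_one]
    rfl
  rw [this, mem_ideal_span_monomial_image]
  simp

lemma mem_clutterCompl {n d : ℕ} {C : Finset (Finset (Fin n))} {F : Finset (Fin n)} :
    F ∈ clutterCompl d C ↔ F.card = d ∧ F ∉ C := by
  simp [clutterCompl]

/-- A sphere triangulation with more than four vertices contains no tetrahedron. -/
lemma IsSphereTriangulation.exists_notMem {n : ℕ} (hn : 5 ≤ n) {P : Finset (Finset (Fin n))}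
    (hP : IsSphereTriangulation P) {Q : Finset (Fin n)} (hQ : Q.card = 4) :
    ∃ G ⊆ Q, G.card = 3 ∧ G ∉ P := by
  obtain ⟨hcard, -, hedge, -, hlink, hconn, -⟩ := hP
  by_contra! hall
  have hstep : ∀ v ∈ Q, ∀ a ∈ Q, a ≠ v → ∀ b, ({v, a, b} : Finset (Fin n)) ∈ P → b ∈ Q := by
    intro v hv a ha hav b hb
    by_contra hbQ
    have h2 : ((Q.erase v).erase a).card = 2 := by
      rw [Finset.card_erase_of_mem (Finset.mem_erase.2 ⟨hav, ha⟩), Finset.card_erase_of_mem hv, hQ]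
    obtain ⟨c, d, hcd, hcdQ⟩ := Finset.card_eq_two.1 h2
    have hc : c ∈ (Q.erase v).erase a := by simp [hcdQ]
    have hd : d ∈ (Q.erase v).erase a := by simp [hcdQ]
    simp only [Finset.mem_erase] at hc hd
    obtain ⟨hca, hcv, hcQ⟩ := hc
    obtain ⟨hda, hdv, hdQ⟩ := hd
    have hface : ∀ x ∈ Q, x ≠ a → x ≠ v → ({v, a, x} : Finset (Fin n)) ∈ P := by
      intro x hx hxa hxv
      refine hall _ ?_ (Finset.card_eq_three.2 ⟨v, a, x, hav.symm, hxv.symm, hxa.symm, rfl⟩)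
      intro y hy
      simp only [Finset.mem_insert, Finset.mem_singleton] at hy
      rcases hy with rfl | rfl | rfl <;> assumption
    have hbv : b ≠ v := by rintro rfl; exact hbQ hv
    have hba : b ≠ a := by rintro rfl; exact hbQ ha
    have hbc : b ≠ c := by rintro rfl; exact hbQ hcQ
    have hbd : b ≠ d := by rintro rfl; exact hbQ hdQ
    have hne : ∀ x y : Fin n, x ≠ v → x ≠ a → x ≠ y →
        ({v, a, x} : Finset (Fin n)) ≠ {v, a, y} := by
      intro x y h1 h2 h3 h
      have : x ∈ ({v, a, y} : Finset (Fin n)) := h ▸ by simp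
      simp [h1, h2, h3] at this
    have hsub : ({{v, a, b}, {v, a, c}, {v, a, d}} : Finset (Finset (Fin n))) ⊆
        P.filter (fun F => {v, a} ⊆ F) := by
      intro F hF
      simp only [Finset.mem_insert, Finset.mem_singleton] at hF
      rw [Finset.mem_filter]
      rcases hF with rfl | rfl | rfl
      · exact ⟨hb, by intro y; simp; tauto⟩
      · exact ⟨hface c hcQ hca hcv, by intro y; simp; tauto⟩
      · exact ⟨hface d hdQ hda hdv, by intro y; simp; tauto⟩
    have h3 := Finset.card_le_card hsub
    rw [hedge {v, a} (Finset.card_pair hav.symm)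
      ⟨_, hface c hcQ hca hcv, by intro y; simp; tauto⟩,
      Finset.card_eq_three.2 ⟨_, _, _, hne b c hbv hba hbc, hne b d hbv hba hbd,
        hne c d hcv hca hcd, rfl⟩] at h3
    omega
  have hnbr : ∀ v ∈ Q, ∀ w, w ≠ v → (∃ F ∈ P, v ∈ F ∧ w ∈ F) → w ∈ Q := by
    intro v hv w hwv hw
    have h3 : (Q.erase v).card = 3 := by rw [Finset.card_erase_of_mem hv, hQ]
    obtain ⟨u, hu, x, hx, hux⟩ := Finset.one_lt_card.1 (show 1 < (Q.erase v).card by omega)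
    rw [Finset.mem_erase] at hu hx
    have huF : ∃ F ∈ P, v ∈ F ∧ u ∈ F := by
      refine ⟨{v, u, x}, hall _ ?_ (Finset.card_eq_three.2
        ⟨v, u, x, hu.1.symm, hx.1.symm, hux, rfl⟩), by simp, by simp⟩
      intro y hy
      simp only [Finset.mem_insert, Finset.mem_singleton] at hy
      rcases hy with rfl | rfl | rfl
      exacts [hv, hu.2, hx.2]
    have hpath := hlink v u w hu.1 hwv huF hw
    refine (?_ : w ∈ Q ∧ w ≠ v).1
    clear hw hwv
    induction hpath with
    | refl => exact ⟨hu.2, hu.1⟩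
    | tail _ hab ih =>
      refine ⟨hstep v hv _ ih.1 ih.2 _ hab.2, ?_⟩
      rintro rfl
      have := hcard _ hab.2
      rw [Finset.insert_eq_of_mem (by simp)] at this
      have := this.symm.trans_le Finset.card_le_two
      omega
  obtain ⟨v, hv⟩ := Finset.card_pos.1 (show 0 < Q.card by omega)
  have huniv : ∀ w, w ∈ Q := by
    intro w
    induction hconn v w with
    | refl => exact hv
    | tail _ hab ih => exact hnbr _ ih _ hab.1.symm hab.2
  have := Finset.card_le_card (fun w _ => huniv w : Finset.univ ⊆ Q)
  rw [Finset.card_univ, Fintype.card_fin] at this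
  omega

/-- A linear resolution would make every function on the faces a simplicial coboundary. -/
lemma HasLinearResolution.exists_koszulD_eq_ite {K : Type*} [Field K] {n : ℕ} (hn : 5 ≤ n)
    {P : Finset (Finset (Fin n))} (hP : IsSphereTriangulation P)
    (h : HasLinearResolution 3 (circuitIdeal K (clutterCompl 3 P)))
    {F₀ : Finset (Fin n)} (hF₀ : F₀ ∈ P) :
    ∃ w : Finset (Fin n) → K, ∀ F ∈ P,
      koszulD (fun _ => (1 : K)) K w Fᶜ = if F = F₀ then 1 else 0 := by
  have hcard := hP.1
  let m : Finset (Fin n) → MvPolynomial (Fin n) K :=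
    fun T => if T = F₀ᶜ then monomial (finsetExponent F₀) 1 else 0
  have hterm : ∀ T, ∀ j ∈ Tᶜ, (koszulSign (MvPolynomial (Fin n) K) j T * X j) • m (insert j T) ∈
      circuitIdeal K (clutterCompl 3 P) ∧ ((koszulSign (MvPolynomial (Fin n) K) j T * X j) •
        m (insert j T)).IsHomogeneous (1 + 3) := by
    intro T j hj
    simp only [m]
    split_ifs with hT
    swap
    · rw [smul_zero]
      exact ⟨zero_mem _, isHomogeneous_zero _ _ _⟩
    have hjF : j ∉ F₀ := by
      rw [← Finset.mem_compl, ← hT]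
      exact Finset.mem_insert_self _ _
    have hs : (koszulSign (MvPolynomial (Fin n) K) j T) = C (koszulSign K j T) := by
      simp [koszulSign]
    have hc : (insert j F₀).card = 4 := by rw [Finset.card_insert_of_notMem hjF, hcard _ hF₀]
    rw [hs, C_mul_X_eq_monomial, smul_eq_mul, monomial_mul, single_add_finsetExponent hjF]
    constructor
    · rw [mem_circuitIdeal_iff]
      intro a ha
      obtain rfl := Finset.mem_singleton.1 (support_monomial_subset ha)
      obtain ⟨G, hG, hG3, hGP⟩ := hP.exists_notMem hn hc
      exact ⟨G, mem_clutterCompl.2 ⟨hG3, hGP⟩, finsetExponent_le_iff.2 hG⟩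
    · refine isHomogeneous_monomial _ ?_
      simp [finsetExponent, hc]
  obtain ⟨ξ, hξI, hξ⟩ := h.exists_koszulD_eq (koszulD_koszulD (X (R := K)) m)
    (fun T => Ideal.sum_mem _ fun j hj => (hterm T j hj).1)
    (fun T => IsHomogeneous.sum _ _ _ fun j hj => (hterm T j hj).2)
  have hξ0 : ∀ (F T : Finset (Fin n)), F ∈ P ∨ F = ∅ → coeff (finsetExponent F) (ξ T) = 0 := by
    intro F T hF
    by_contra hne
    obtain ⟨G, hG, hGF⟩ := mem_circuitIdeal_iff.1 (hξI T) _ (mem_support_iff.2 hne)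
    rw [mem_clutterCompl] at hG
    rw [finsetExponent_le_iff] at hGF
    rcases hF with hF | rfl
    · exact hG.2 (Finset.eq_of_subset_of_card_le hGF (by rw [hG.1, hcard F hF]) ▸ hF)
    · have := Finset.card_le_card hGF
      simp [hG.1] at this
  obtain ⟨ω, hω⟩ := _root_.exists_koszulD_eq (m - ξ) (by rw [map_sub, hξ, sub_self]) (by
    have h1 := hξ0 ∅ ∅ (Or.inr rfl)
    rw [show finsetExponent (∅ : Finset (Fin n)) = 0 from Finset.sum_empty] at h1
    rw [Pi.sub_apply, coeff_sub, h1, sub_zero]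
    simp only [m]
    split_ifs
    · rw [coeff_monomial, if_neg]
      intro h0
      have := congrArg Finsupp.degree h0
      simp [finsetExponent, hcard _ hF₀] at this
    · simp)
  refine ⟨fun T => coeff (finsetExponent Tᶜ) (ω T), fun F hF => ?_⟩
  have h1 : koszulD (fun _ => (1 : K)) K (fun T => coeff (finsetExponent Tᶜ) (ω T)) Fᶜ =
      coeff (finsetExponent F) (koszulD (X (R := K)) (MvPolynomial (Fin n) K) ω Fᶜ) := by
    rw [koszulD_apply, coeff_koszulD]
    refine Finset.sum_congr rfl fun j hj => ?_
    rw [compl_compl] at hj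
    rw [if_neg (by simp [finsetExponent_apply, hj]), finsetExponent_sub_single, mul_one,
      smul_eq_mul, Finset.compl_insert, compl_compl]
  rw [h1, hω, Pi.sub_apply, coeff_sub, hξ0 F _ (Or.inl hF), sub_zero]
  simp only [m, compl_inj_iff]
  split_ifs with hFF
  · rw [hFF, coeff_monomial, if_pos rfl]
  · simp

/-- By Euler's relation, not every function on the faces of a sphere triangulation is a
coboundary. -/
lemma IsSphereTriangulation.not_forall_exists_koszulD_eq_ite (K : Type*) [Field K] {n : ℕ}
    (hn : 5 ≤ n) {P : Finset (Finset (Fin n))} (hP : IsSphereTriangulation P)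
    (h : ∀ F₀ ∈ P, ∃ w : Finset (Fin n) → K, ∀ F ∈ P,
      koszulD (fun _ => (1 : K)) K w Fᶜ = if F = F₀ then 1 else 0) : False := by
  classical
  obtain ⟨hcard, -, -, -, -, hconn, heuler⟩ := hP
  set E := (Finset.powersetCard 2 (Finset.univ : Finset (Fin n))).filter
    (fun e => ∃ F ∈ P, e ⊆ F) with hE
  have hmemE : ∀ F ∈ P, ∀ j ∈ F, F.erase j ∈ E := by
    intro F hF j hj
    simp only [hE, Finset.mem_filter, Finset.mem_powersetCard, Finset.subset_univ, true_and]
    exact ⟨by rw [Finset.card_erase_of_mem hj, hcard F hF], F, hF, Finset.erase_subset _ _⟩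
  -- functions on vertices and on edges, extended to the Koszul complex by complementation
  let extV : (Fin n → K) →ₗ[K] (Finset (Fin n) → K) :=
    { toFun := fun u T => ∑ v ∈ Tᶜ, u v
      map_add' := fun u u' => by ext T; simp [Finset.sum_add_distrib]
      map_smul' := fun r u => by ext T; simp [Finset.mul_sum] }
  let extE : (E → K) →ₗ[K] (Finset (Fin n) → K) :=
    { toFun := fun w T => if hT : Tᶜ ∈ E then w ⟨Tᶜ, hT⟩ else 0
      map_add' := fun w w' => by ext T; by_cases hT : Tᶜ ∈ E <;> simp [hT]
      map_smul' := fun r w => by ext T; by_cases hT : Tᶜ ∈ E <;> simp [hT] }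
  let δ₀ : (Fin n → K) →ₗ[K] (E → K) :=
    LinearMap.funLeft K K (fun e : E => (e : Finset (Fin n))ᶜ) ∘ₗ koszulD (fun _ => (1 : K)) K ∘ₗ
      extV
  let δ₁ : (E → K) →ₗ[K] (P → K) :=
    LinearMap.funLeft K K (fun F : P => (F : Finset (Fin n))ᶜ) ∘ₗ koszulD (fun _ => (1 : K)) K ∘ₗ
      extE
  have hδ₁ (w : E → K) (w' : Finset (Fin n) → K) (hw : ∀ e : E, w e = w' (e : Finset (Fin n))ᶜ)
      (F : P) : δ₁ w F = koszulD (fun _ => (1 : K)) K w' (F : Finset (Fin n))ᶜ := by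
    change koszulD (fun _ => (1 : K)) K (extE w) (F : Finset (Fin n))ᶜ = _
    rw [koszulD_apply, koszulD_apply]
    refine Finset.sum_congr rfl fun j hj => ?_
    rw [compl_compl] at hj
    congr 1
    have hmem : (insert j (F : Finset (Fin n))ᶜ)ᶜ ∈ E := by
      rw [Finset.compl_insert, compl_compl]
      exact hmemE _ F.2 j hj
    change (if hT : _ then _ else _) = _
    rw [dif_pos hmem, hw, compl_compl]
  have hsurj : LinearMap.range δ₁ = ⊤ := by
    rw [eq_top_iff, ← (Pi.basisFun K P).span_eq, Submodule.span_le]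
    rintro _ ⟨F₀, rfl⟩
    obtain ⟨w, hw⟩ := h F₀ F₀.2
    refine ⟨fun e => w (e : Finset (Fin n))ᶜ, ?_⟩
    ext F
    rw [hδ₁ _ w (fun _ => rfl), hw F F.2]
    simp only [Pi.basisFun_apply, Pi.single_apply, Subtype.coe_inj]
  have hcomplex : LinearMap.range δ₀ ≤ LinearMap.ker δ₁ := by
    rintro _ ⟨u, rfl⟩
    rw [LinearMap.mem_ker]
    ext F
    rw [hδ₁ (δ₀ u) (koszulD (fun _ => (1 : K)) K (extV u)) (fun _ => rfl), koszulD_koszulD]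
    rfl
  have hker : Module.finrank K (LinearMap.ker δ₀) ≤ 1 := by
    let v₀ : Fin n := ⟨0, by omega⟩
    have hinj : Function.Injective
        ((LinearMap.proj v₀ : (Fin n → K) →ₗ[K] K) ∘ₗ (LinearMap.ker δ₀).subtype) := by
      rw [injective_iff_map_eq_zero]
      rintro ⟨u, hu⟩ hu0
      have hu0' : u v₀ = 0 := hu0
      refine Subtype.ext (funext fun v => ?_)
      change u v = 0
      induction hconn v₀ v with
      | refl => exact hu0'
      | @tail a b _ hab ih =>
        obtain ⟨hne, F, hF, ha, hb⟩ := hab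
        have hmem : ({a, b} : Finset (Fin n)) ∈ E := by
          simp only [hE, Finset.mem_filter, Finset.mem_powersetCard, Finset.subset_univ, true_and]
          refine ⟨Finset.card_pair hne, F, hF, ?_⟩
          simp [Finset.insert_subset_iff, ha, hb]
        have h0 : koszulD (fun _ => (1 : K)) K (extV u) ({a, b} : Finset (Fin n))ᶜ = 0 :=
          congrFun (LinearMap.mem_ker.1 hu) ⟨_, hmem⟩
        have hV (T) : extV u T = ∑ v ∈ Tᶜ, u v := rfl
        have hA : (insert a ({a, b} : Finset (Fin n))ᶜ)ᶜ = {b} := by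
          rw [Finset.compl_insert, compl_compl, Finset.erase_insert (by simpa using hne)]
        have hB : (insert b ({a, b} : Finset (Fin n))ᶜ)ᶜ = {a} := by
          rw [Finset.compl_insert, compl_compl, Finset.pair_comm,
            Finset.erase_insert (by simpa using hne.symm)]
        rw [koszulD_apply, compl_compl, Finset.sum_pair hne, hV, hV, hA, hB,
          Finset.sum_singleton, Finset.sum_singleton, ih, smul_zero, add_zero, mul_one,
          smul_eq_mul] at h0
        have hsq := koszulSign_mul_self K a ({a, b} : Finset (Fin n))ᶜ
        linear_combination koszulSign K a ({a, b} : Finset (Fin n))ᶜ * h0 - u b * hsq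
    simpa using LinearMap.finrank_le_finrank_of_injective hinj
  have h1 := δ₀.finrank_range_add_finrank_ker
  have h2 := δ₁.finrank_range_add_finrank_ker
  have h3 := Submodule.finrank_mono hcomplex
  rw [hsurj, finrank_top] at h2
  simp only [Module.finrank_fintype_fun_eq_card, Fintype.card_fin, Fintype.card_coe] at h1 h2
  omega

/-- Let `𝔓ₙ` be the 3-uniform clutter of the triangular faces of a
triangulation of the 2-sphere on `n ≥ 5` vertices, and let `I = I(𝔓̄ₙ)` be the circuit
ideal of its complement.  Then `I` does not have a 3-linear resolution. -/
theorem sphere_triangulation_not_linear {K : Type*} [Field K] (n : ℕ) (hn : 5 ≤ n)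
    (P : Finset (Finset (Fin n))) (hP : IsSphereTriangulation P) :
    ¬ HasLinearResolution 3 (circuitIdeal K (clutterCompl 3 P)) := by
  exact fun h => hP.not_forall_exists_koszulD_eq_ite K hn fun _ hF =>
    h.exists_koszulD_eq_ite hn hP hF
end
end
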